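/- arXiv:2406.03167 — 5 statements merged into one kernel-verified Lean document; each statement's English description precedes it below -/
import Mathlib

section
/- Let (σ, v) be a signed tropical Plücker function of rank r on a finite linearly ordered set E with values in a linearly ordered abelian group Γ, and suppose σ is nonnegative, i.e. σ(B) ∈ {0, +1} for every r-subset B. Then (σ, v) is an oriented valuated matroid (equivalently, an 𝕊[Γ]-positroid) if and only if, for every u : E → Γ, the initial sign function σ^u is a chirotope of rank r on E; note that each σ^u then automatically takes values in {0, +1}, i.e. is a positively oriented matroid (a positroid). (This is Theorem C(i) of the paper for F = 𝕊.) -/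
open scoped Classical

/-- Subtraction of a group element from `Γ ∪ {∞}`, with `∞ - g = ∞`. -/
def wsub {Γ : Type*} [AddCommGroup Γ] [LinearOrder Γ] [IsOrderedAddMonoid Γ] (x : WithTop Γ) (g : Γ) : WithTop Γ :=
  x.map fun γ => γ - g

/-- `sign(j; I, J) = (-1)^ℓ ∈ {+1, -1}`, where `ℓ` is the number of `j' ∈ J` with `j < j'` plus
the number of `i ∈ I` with `j < i`. -/
def ssign {E : Type*} [LinearOrder E] (j : E) (I J : Finset E) : SignType :=
  (-1 : SignType) ^ ((J.filter fun j' => j < j').card + (I.filter fun i => j < i).card)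

/-- The pair `(σ, v)` is an oriented valuated matroid (a strong `𝕊[Γ]`-matroid) of rank `r`:
for every `(r-1)`-subset `I` and `(r+1)`-subset `J`, letting `m` be the minimum of
`v(I∪{j}) + v(J∖{j})` over `j ∈ J∖I`, either `m = ∞` or both `+1` and `-1` occur among the
products `sign(j;I,J)·σ(I∪{j})·σ(J∖{j})` over the minimisers. -/
def OrientedValuatedMatroid {E : Type*} [Fintype E] [LinearOrder E]
    {Γ : Type*} [AddCommGroup Γ] [LinearOrder Γ] [IsOrderedAddMonoid Γ]
    (σ : Finset E → SignType) (v : Finset E → WithTop Γ) (r : ℕ) : Prop :=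
  ∀ I J : Finset E, I.card + 1 = r → J.card = r + 1 →
    (∀ j ∈ J \ I, v (insert j I) + v (J.erase j) = ⊤) ∨
    ((∃ j ∈ J \ I,
        (∀ k ∈ J \ I, v (insert j I) + v (J.erase j) ≤ v (insert k I) + v (J.erase k)) ∧
        ssign j I J * σ (insert j I) * σ (J.erase j) = 1) ∧
     (∃ j ∈ J \ I,
        (∀ k ∈ J \ I, v (insert j I) + v (J.erase j) ≤ v (insert k I) + v (J.erase k)) ∧
        ssign j I J * σ (insert j I) * σ (J.erase j) = -1))

/-- `χ` is a chirotope of rank `r` on `E`: it is not identically `0` on `r`-subsets, and for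
every `(r-1)`-subset `I` and `(r+1)`-subset `J`, either all products
`sign(j;I,J)·χ(I∪{j})·χ(J∖{j})`, `j ∈ J∖I`, are `0`, or both `+1` and `-1` occur among them. -/
def IsChirotope {E : Type*} [Fintype E] [LinearOrder E]
    (χ : Finset E → SignType) (r : ℕ) : Prop :=
  (∃ B : Finset E, B.card = r ∧ χ B ≠ 0) ∧
  ∀ I J : Finset E, I.card + 1 = r → J.card = r + 1 →
    (∀ j ∈ J \ I, ssign j I J * χ (insert j I) * χ (J.erase j) = 0) ∨
    ((∃ j ∈ J \ I, ssign j I J * χ (insert j I) * χ (J.erase j) = 1) ∧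
     (∃ j ∈ J \ I, ssign j I J * χ (insert j I) * χ (J.erase j) = -1))

/-- The initial sign function `σ^u`: `σ^u(B) = σ(B)` if `v(B) ≠ ∞` and `v(B) - ∑_{i∈B} u_i` is
minimal among all `r`-subsets, and `σ^u(B) = 0` otherwise. -/
noncomputable def initSign {E : Type*} [Fintype E] {Γ : Type*} [AddCommGroup Γ] [LinearOrder Γ] [IsOrderedAddMonoid Γ]
    (σ : Finset E → SignType) (v : Finset E → WithTop Γ) (r : ℕ) (u : E → Γ)
    (B : Finset E) : SignType :=
  if v B ≠ ⊤ ∧ ∀ B' : Finset E, B'.card = r →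
      wsub (v B) (∑ i ∈ B, u i) ≤ wsub (v B') (∑ i ∈ B', u i)
  then σ B else 0

theorem pl_row {E Γ A : Type*} [AddCommGroup Γ] [LinearOrder Γ] [IsOrderedAddMonoid Γ]
    [LinearOrder A] (key : E → A) (K : Finset E) (c d : E → WithTop Γ) (p : E → E → WithTop Γ)
    (ε : E → SignType)
    (hR : ∀ j ∈ K, ∀ t ∈ K, t ≠ j → d t + p j t ≠ ⊤ →
      (∀ k ∈ K, k ≠ j → d t + p j t ≤ d k + p j k) →
      ∃ t' ∈ K, t' ≠ j ∧ d t' + p j t' = d t + p j t ∧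
        ((key t < key j ↔ key t' < key j) → ε t' = - ε t))
    (a : E) (ha : a ∈ K) (hfin : c a + d a ≠ ⊤) (hmin : ∀ k ∈ K, c a + d a ≤ c k + d k)
    (j : E) (hj : j ∈ K) (haj : a ≠ j) (κ κ' : WithTop Γ) (hκ : κ ≠ ⊤) (hκ' : κ' ≠ ⊤)
    (h1 : κ + (d a + p j a) = c a + d a + κ')
    (h2 : ∀ k ∈ K, k ≠ j → c k + d k + κ' ≤ κ + (d k + p j k))
    (hside : ∀ k ∈ K, k ≠ j → c k ≠ ⊤ → (key a < key j ↔ key k < key j)) :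
    ∃ t ∈ K, c t + d t = c a + d a ∧ ε t = - ε a := by
  have f1 : d a + p j a ≠ ⊤ := by
    intro h
    rw [h, WithTop.add_top] at h1
    have := WithTop.add_ne_top.2 ⟨hfin, hκ'⟩
    exact this h1.symm
  have hm : ∀ k ∈ K, k ≠ j → d a + p j a ≤ d k + p j k := by
    intro k hk hkj
    rw [← WithTop.add_le_add_iff_left hκ, h1]
    exact (add_le_add_left (hmin k hk) κ').trans (h2 k hk hkj)
  obtain ⟨t, ht, htj, hte, hts⟩ := hR j hj a ha haj f1 hm
  have e1 : c t + d t = c a + d a := by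
    apply le_antisymm _ (hmin t ht)
    rw [← WithTop.add_le_add_iff_right hκ', ← h1, ← hte]
    exact h2 t ht htj
  refine ⟨t, ht, e1, hts (hside t ht htj ?_)⟩
  intro h
  rw [h, WithTop.top_add] at e1
  exact hfin e1.symm

/-- half: elements before the support -/
theorem pl_before {E Γ A : Type*} [AddCommGroup Γ] [LinearOrder Γ] [IsOrderedAddMonoid Γ]
    [LinearOrder A] (key : E → A) (hk : Function.Injective key)
    (K : Finset E) (c d : E → WithTop Γ) (p : E → E → WithTop Γ)
    (hp : ∀ x y, p x y = p y x)
    (ε : E → SignType)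
    (hT : ∀ l ∈ K, ∀ m ∈ K, ∀ n ∈ K, key l < key m → key m < key n →
      c m + p l n = min (c l + p m n) (c n + p l m))
    (hR : ∀ j ∈ K, ∀ t ∈ K, t ≠ j → d t + p j t ≠ ⊤ →
      (∀ k ∈ K, k ≠ j → d t + p j t ≤ d k + p j k) →
      ∃ t' ∈ K, t' ≠ j ∧ d t' + p j t' = d t + p j t ∧
        ((key t < key j ↔ key t' < key j) → ε t' = - ε t))
    (a : E) (ha : a ∈ K) (hfin : c a + d a ≠ ⊤) (hmin : ∀ k ∈ K, c a + d a ≤ c k + d k)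
    (j : E) (hj : j ∈ K) (hcj : c j ≠ ⊤) (hjm : ∀ k ∈ K, c k ≠ ⊤ → key j ≤ key k)
    (l : E) (hl : l ∈ K) (hcl : c l = ⊤) (hlj : key l < key j) (hpl : p l j ≠ ⊤) :
    ∃ t ∈ K, c t + d t = c a + d a ∧ ε t = - ε a := by
  have hca : c a ≠ ⊤ := by
    intro h; rw [h, WithTop.top_add] at hfin; exact hfin rfl
  have key1 : ∀ m ∈ K, c m ≠ ⊤ → c j + (d m + p l m) = c m + d m + p l j := by
    intro m hm hcm
    rcases (hjm m hm hcm).eq_or_lt with h | h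
    · have := hk h; subst this
      exact (add_assoc _ _ _).symm
    · have := hT l hl j hj m hm hlj h
      rw [hcl, WithTop.top_add, min_eq_right le_top] at this
      rw [add_left_comm, this, add_left_comm, add_assoc]
  have key2 : ∀ m ∈ K, m ≠ l → c m = ⊤ → p l m = ⊤ := by
    intro m hm hml hcm
    have fin : c j + p l m = ⊤ → p l m = ⊤ := by
      intro h
      rcases WithTop.add_eq_top.1 h with h | h
      · exact absurd h hcj
      · exact h
    apply fin
    rcases lt_trichotomy (key m) (key j) with h | h | h
    · rcases lt_trichotomy (key m) (key l) with h' | h' | h'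
      · have := hT m hm l hl j hj h' hlj
        rw [hcl, WithTop.top_add, hcm, WithTop.top_add, min_eq_right le_top] at this
        rw [hp l m]; exact this.symm
      · exact absurd (hk h') hml
      · have := hT l hl m hm j hj h' h
        rw [hcl, WithTop.top_add, hcm, WithTop.top_add, min_eq_right le_top] at this
        exact this.symm
    · have := hk h; subst this; exact absurd hcm hcj
    · have := hT l hl j hj m hm hlj h
      rw [hcl, WithTop.top_add, hcm, WithTop.top_add, min_eq_right le_top] at this
      exact this
  refine pl_row key K c d p ε hR a ha hfin hmin l hl ?_ (c j) (p l j) hcj hpl (key1 a ha hca) ?_ ?_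
  · rintro rfl; exact hca hcl
  · intro k hkK hkl
    by_cases hck : c k = ⊤
    · rw [key2 k hkK hkl hck]; simp
    · exact (key1 k hkK hck).ge
  · intro k hkK hkl hck
    have h1 := hlj.trans_le (hjm k hkK hck)
    have h2 := hlj.trans_le (hjm a ha hca)
    exact ⟨fun h => absurd h h2.not_gt, fun h => absurd h h1.not_gt⟩

theorem pl_caseA {E Γ A : Type*} [AddCommGroup Γ] [LinearOrder Γ] [IsOrderedAddMonoid Γ]
    [LinearOrder A] (key : E → A) (hk : Function.Injective key)
    (K : Finset E) (c d : E → WithTop Γ) (p : E → E → WithTop Γ)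
    (hp : ∀ x y, p x y = p y x)
    (ε : E → SignType)
    (hT : ∀ l ∈ K, ∀ m ∈ K, ∀ n ∈ K, key l < key m → key m < key n →
      c m + p l n = min (c l + p m n) (c n + p l m))
    (hR : ∀ j ∈ K, ∀ t ∈ K, t ≠ j → d t + p j t ≠ ⊤ →
      (∀ k ∈ K, k ≠ j → d t + p j t ≤ d k + p j k) →
      ∃ t' ∈ K, t' ≠ j ∧ d t' + p j t' = d t + p j t ∧
        ((key t < key j ↔ key t' < key j) → ε t' = - ε t))
    (a : E) (ha : a ∈ K) (hfin : c a + d a ≠ ⊤) (hmin : ∀ k ∈ K, c a + d a ≤ c k + d k)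
    (j : E) (hj : j ∈ K) (hcj : c j ≠ ⊤) (hjm : ∀ k ∈ K, c k ≠ ⊤ → key j ≤ key k)
    (j' : E) (hj' : j' ∈ K) (hcj' : c j' ≠ ⊤) (hjm' : ∀ k ∈ K, c k ≠ ⊤ → key k ≤ key j')
    (hpj : p j j' ≠ ⊤) (hloop : ∀ k ∈ K, c k = ⊤ → p j k = ⊤) (haj : a ≠ j)
    (hA : c a + p j j' = c j' + p j a) :
    ∃ t ∈ K, c t + d t = c a + d a ∧ ε t = - ε a := by
  have hca : c a ≠ ⊤ := by
    intro h; rw [h, WithTop.top_add] at hfin; exact hfin rfl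
  refine pl_row key K c d p ε hR a ha hfin hmin j hj haj (c j') (p j j') hcj' hpj ?_ ?_ ?_
  · rw [add_left_comm, ← hA, add_left_comm, add_assoc]
  · intro k hkK hkj
    by_cases hck : c k = ⊤
    · rw [hloop k hkK hck]; simp
    · have hl : c k + p j j' ≤ c j' + p j k := by
        rcases (hjm' k hkK hck).eq_or_lt with h | h
        · have := hk h; subst this; exact le_rfl
        · have h2 : key j < key k := lt_of_le_of_ne (hjm k hkK hck) fun h => hkj (hk h).symm
          rw [hT j hj k hkK j' hj' h2 h]
          exact min_le_right _ _
      calc c k + d k + p j j' = d k + (c k + p j j') := by rw [add_assoc, add_left_comm]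
        _ ≤ d k + (c j' + p j k) := by gcongr
        _ = _ := add_left_comm _ _ _
  · intro k hkK hkl hck
    exact ⟨fun h => absurd h (hjm a ha hca).not_gt, fun h => absurd h (hjm k hkK hck).not_gt⟩

theorem pl_main {E Γ A : Type*} [AddCommGroup Γ] [LinearOrder Γ] [IsOrderedAddMonoid Γ]
    [LinearOrder A] (key : E → A) (hk : Function.Injective key)
    (K : Finset E) (c d : E → WithTop Γ) (p : E → E → WithTop Γ)
    (hp : ∀ x y, p x y = p y x)
    (ε : E → SignType)
    (hT : ∀ l ∈ K, ∀ m ∈ K, ∀ n ∈ K, key l < key m → key m < key n →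
      c m + p l n = min (c l + p m n) (c n + p l m))
    (hR : ∀ j ∈ K, ∀ t ∈ K, t ≠ j → d t + p j t ≠ ⊤ →
      (∀ k ∈ K, k ≠ j → d t + p j t ≤ d k + p j k) →
      ∃ t' ∈ K, t' ≠ j ∧ d t' + p j t' = d t + p j t ∧
        ((key t < key j ↔ key t' < key j) → ε t' = - ε t))
    (a : E) (ha : a ∈ K) (hfin : c a + d a ≠ ⊤) (hmin : ∀ k ∈ K, c a + d a ≤ c k + d k)
    (hC : ∃ m ∈ K, ∃ m' ∈ K, m ≠ m' ∧ c m ≠ ⊤ ∧ c m' ≠ ⊤ ∧ p m m' ≠ ⊤) :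
    ∃ t ∈ K, c t + d t = c a + d a ∧ ε t = - ε a := by
  by_contra hcon
  have hca : c a ≠ ⊤ := by
    intro h; rw [h, WithTop.top_add] at hfin; exact hfin rfl
  have hT' : ∀ l ∈ K, ∀ m ∈ K, ∀ n ∈ K, OrderDual.toDual (key l) < OrderDual.toDual (key m) →
      OrderDual.toDual (key m) < OrderDual.toDual (key n) →
      c m + p l n = min (c l + p m n) (c n + p l m) := by
    intro l hl m hm n hn h1 h2
    have := hT n hn m hm l hl (OrderDual.toDual_lt_toDual.1 h2) (OrderDual.toDual_lt_toDual.1 h1)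
    rw [hp l n, this, min_comm, hp m l, hp n m]
  have hR' : ∀ j ∈ K, ∀ t ∈ K, t ≠ j → d t + p j t ≠ ⊤ →
      (∀ k ∈ K, k ≠ j → d t + p j t ≤ d k + p j k) →
      ∃ t' ∈ K, t' ≠ j ∧ d t' + p j t' = d t + p j t ∧
        ((OrderDual.toDual (key t) < OrderDual.toDual (key j) ↔
          OrderDual.toDual (key t') < OrderDual.toDual (key j)) → ε t' = - ε t) := by
    intro j hj t ht htj h1 h2
    obtain ⟨t', ht', htj', he, hs⟩ := hR j hj t ht htj h1 h2
    refine ⟨t', ht', htj', he, fun h => hs ?_⟩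
    rw [OrderDual.toDual_lt_toDual, OrderDual.toDual_lt_toDual] at h
    have n1 : key t ≠ key j := fun h => htj (hk h)
    have n2 : key t' ≠ key j := fun h => htj' (hk h)
    constructor
    · intro h'
      exact lt_of_le_of_ne (not_lt.1 fun h'' => (h.2 h'').not_gt h') n2
    · intro h'
      exact lt_of_le_of_ne (not_lt.1 fun h'' => (h.1 h'').not_gt h') n1
  have hk' : Function.Injective (fun x => OrderDual.toDual (key x)) := fun x y h => hk h
  have memC : ∀ x, x ∈ K.filter (fun x => c x ≠ ⊤) ↔ x ∈ K ∧ c x ≠ ⊤ := fun x => Finset.mem_filter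
  have hne : (K.filter (fun x => c x ≠ ⊤)).Nonempty := ⟨a, (memC a).2 ⟨ha, hca⟩⟩
  obtain ⟨j, hjC, hjm⟩ := Finset.exists_min_image _ key hne
  obtain ⟨j', hjC', hjm'⟩ := Finset.exists_max_image _ key hne
  obtain ⟨hj, hcj⟩ := (memC j).1 hjC
  obtain ⟨hj', hcj'⟩ := (memC j').1 hjC'
  replace hjm : ∀ k ∈ K, c k ≠ ⊤ → key j ≤ key k := fun k h1 h2 => hjm k ((memC k).2 ⟨h1, h2⟩)
  replace hjm' : ∀ k ∈ K, c k ≠ ⊤ → key k ≤ key j' := fun k h1 h2 => hjm' k ((memC k).2 ⟨h1, h2⟩)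
  -- finite
  have hpj : p j j' ≠ ⊤ ∧ j ≠ j' := by
    obtain ⟨m, hm, m', hm', hlt, hcm, hcm', hpm⟩ : ∃ m ∈ K, ∃ m' ∈ K, key m < key m' ∧
        c m ≠ ⊤ ∧ c m' ≠ ⊤ ∧ p m m' ≠ ⊤ := by
      obtain ⟨m, hm, m', hm', hne, h1, h2, h3⟩ := hC
      rcases lt_trichotomy (key m) (key m') with h | h | h
      · exact ⟨m, hm, m', hm', h, h1, h2, h3⟩
      · exact absurd (hk h) hne
      · exact ⟨m', hm', m, hm, h, h2, h1, by rwa [hp]⟩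
    have s1 : p j m' ≠ ⊤ := by
      rcases (hjm m hm hcm).eq_or_lt with h | h
      · have := hk h; subst this; exact hpm
      · have := hT j hj m hm m' hm' h hlt
        intro h'
        rw [h', WithTop.add_top] at this
        have h3 := this.trans_le (min_le_left _ _)
        rw [top_le_iff, WithTop.add_eq_top] at h3
        tauto
    have hjlt : key j < key m' := (hjm m hm hcm).trans_lt hlt
    constructor
    · rcases (hjm' m' hm' hcm').eq_or_lt with h | h
      · have := hk h; subst this; exact s1
      · have := hT j hj m' hm' j' hj' hjlt h
        intro h'
        rw [h', WithTop.add_top] at this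
        have h3 := this.trans_le (min_le_right _ _)
        rw [top_le_iff, WithTop.add_eq_top] at h3
        tauto
    · rintro rfl
      exact (hjm' m' hm' hcm').not_gt hjlt
  obtain ⟨hpj, hjj⟩ := hpj
  have hjlt : key j < key j' := lt_of_le_of_ne (hjm j' hj' hcj') fun h => hjj (hk h)
  have hbef : ∀ l ∈ K, c l = ⊤ → key l < key j → p l j = ⊤ := by
    intro l hl hcl hlj
    by_contra hpl
    exact hcon (pl_before key hk K c d p hp ε hT hR a ha hfin hmin j hj hcj hjm l hl hcl hlj hpl)
  have haft : ∀ l ∈ K, c l = ⊤ → key j' < key l → p l j' = ⊤ := by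
    intro l hl hcl hlj
    by_contra hpl
    exact hcon (pl_before _ hk' K c d p hp ε hT' hR' a ha hfin hmin j' hj' hcj' hjm' l hl hcl hlj hpl)
  have canc : ∀ x y : WithTop Γ, x ≠ ⊤ → x + y = ⊤ → y = ⊤ := by
    intro x y h1 h2
    rcases WithTop.add_eq_top.1 h2 with h | h
    · exact absurd h h1
    · exact h
  have hmid : ∀ l ∈ K, c l = ⊤ → p j l = ⊤ ∧ p j' l = ⊤ := by
    intro l hl hcl
    rcases lt_trichotomy (key l) (key j) with h | h | h
    · have h1 := hbef l hl hcl h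
      have := hT l hl j hj j' hj' h hjlt
      rw [hcl, WithTop.top_add, h1, WithTop.add_top, min_self] at this
      exact ⟨by rw [hp, h1], by rw [hp]; exact canc _ _ hcj this⟩
    · have := hk h; subst this; exact absurd hcl hcj
    rcases lt_trichotomy (key l) (key j') with h' | h' | h'
    · have := hT j hj l hl j' hj' h h'
      rw [hcl, WithTop.top_add] at this
      have h3 := this.trans_le (min_le_left _ _)
      have h4 := this.trans_le (min_le_right _ _)
      rw [top_le_iff] at h3 h4
      exact ⟨canc _ _ hcj' h4, by rw [hp]; exact canc _ _ hcj h3⟩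
    · have := hk h'; subst this; exact absurd hcl hcj'
    · have h1 := haft l hl hcl h'
      have := hT j hj j' hj' l hl hjlt h'
      rw [hcl, WithTop.top_add, hp j' l, h1, WithTop.add_top, min_self] at this
      exact ⟨canc _ _ hcj' this, by rw [hp, h1]⟩
  have cA : a ≠ j → c a + p j j' = c j' + p j a → False := fun h1 h2 =>
    hcon (pl_caseA key hk K c d p hp ε hT hR a ha hfin hmin j hj hcj hjm j' hj' hcj' hjm' hpj
      (fun k h h' => (hmid k h h').1) h1 h2)
  have cB : a ≠ j' → c a + p j j' = c j + p j' a → False := fun h1 h2 =>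
    hcon (pl_caseA _ hk' K c d p hp ε hT' hR' a ha hfin hmin j' hj' hcj' hjm' j hj hcj hjm
      (by rwa [hp]) (fun k h h' => (hmid k h h').2) h1 (by rwa [hp j' j]))
  by_cases h1 : a = j
  · subst h1
    exact cB hjj (by rw [hp j' a])
  by_cases h2 : a = j'
  · subst h2
    exact cA h1 rfl
  have l1 : key j < key a := lt_of_le_of_ne (hjm a ha hca) fun h => h1 (hk h).symm
  have l2 : key a < key j' := lt_of_le_of_ne (hjm' a ha hca) fun h => h2 (hk h)
  have := hT j hj a ha j' hj' l1 l2
  rcases min_choice (c j + p a j') (c j' + p j a) with h | h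
  · rw [h] at this
    exact cB h2 (by rw [this, hp a j'])
  · rw [h] at this
    exact cA h1 this

/-- `-1` if `x < y`, else `1`. -/
def hsg {E : Type*} [LinearOrder E] (x y : E) : SignType := if x < y then -1 else 1

theorem hsg_or {E : Type*} [LinearOrder E] (x y : E) : hsg x y = 1 ∨ hsg x y = -1 := by
  unfold hsg; split_ifs <;> simp

theorem hsg_self {E : Type*} [LinearOrder E] (x : E) : hsg x x = 1 := by
  simp [hsg]

theorem hsg_swap {E : Type*} [LinearOrder E] {x y : E} (h : x ≠ y) : hsg y x = - hsg x y := by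
  unfold hsg
  rcases lt_or_gt_of_ne h with h | h
  · simp [h, h.not_gt]
  · simp [h, h.not_gt]

theorem ssign_eq {E : Type*} [LinearOrder E] (j : E) (I J : Finset E) :
    ssign j I J = (∏ x ∈ J, hsg j x) * ∏ x ∈ I, hsg j x := by
  unfold ssign hsg
  rw [pow_add, Finset.prod_ite, Finset.prod_ite]
  simp

theorem prod_hsg_sq {E : Type*} [LinearOrder E] (j : E) (S : Finset E) :
    (∏ x ∈ S, hsg j x) * (∏ x ∈ S, hsg j x) = 1 := by
  rw [← Finset.prod_mul_distrib]
  apply Finset.prod_eq_one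
  intro x _
  rcases hsg_or j x with h | h <;> rw [h] <;> decide

theorem ssign_or {E : Type*} [LinearOrder E] (j : E) (I J : Finset E) :
    ssign j I J = 1 ∨ ssign j I J = -1 := by
  unfold ssign
  exact neg_one_pow_eq_or _ _

/-- Global lower bound. -/
def Bnd {E Γ : Type*} [AddCommGroup Γ] [LinearOrder Γ]
    (v : Finset E → WithTop Γ) (r : ℕ) (u : E → Γ) (lam : Γ) : Prop :=
  ∀ B : Finset E, B.card = r → ((lam + ∑ i ∈ B, u i : Γ) : WithTop Γ) ≤ v B

/-- Tightness. -/
def Tight {E Γ : Type*} [AddCommGroup Γ] [LinearOrder Γ]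
    (v : Finset E → WithTop Γ) (u : E → Γ) (lam : Γ) (B : Finset E) : Prop :=
  v B = ((lam + ∑ i ∈ B, u i : Γ) : WithTop Γ)

/-- cell relation -/
def CellRel {E Γ : Type*} [LinearOrder E] [AddCommGroup Γ] [LinearOrder Γ]
    (v : Finset E → WithTop Γ) (r : ℕ) : Prop :=
  ∀ (u : E → Γ) (lam : Γ), Bnd v r u lam → ∀ I J : Finset E, I.card + 1 = r → J.card = r + 1 →
    ∀ j ∈ J \ I, Tight v u lam (insert j I) → Tight v u lam (J.erase j) →
    ∃ j' ∈ J \ I, Tight v u lam (insert j' I) ∧ Tight v u lam (J.erase j') ∧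
      ssign j' I J = - ssign j I J

theorem card_ins {E : Type*} [LinearOrder E] {I J : Finset E} {r : ℕ} (hI : I.card + 1 = r)
    {j : E} (hj : j ∈ J \ I) : (insert j I).card = r := by
  rw [Finset.mem_sdiff] at hj
  rw [Finset.card_insert_of_notMem hj.2, hI]

theorem card_era {E : Type*} [LinearOrder E] {I J : Finset E} {r : ℕ} (hJ : J.card = r + 1)
    {j : E} (hj : j ∈ J \ I) : (J.erase j).card = r := by
  rw [Finset.mem_sdiff] at hj
  rw [Finset.card_erase_of_mem hj.1, hJ]; rfl

theorem cell_of_chirotope {E : Type*} [Fintype E] [LinearOrder E] {Γ : Type*} [AddCommGroup Γ]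
    [LinearOrder Γ] [IsOrderedAddMonoid Γ]
    (r : ℕ) (σ : Finset E → SignType) (v : Finset E → WithTop Γ)
    (hσv : ∀ B : Finset E, B.card = r → (σ B = 0 ↔ v B = ⊤))
    (hpos : ∀ B : Finset E, B.card = r → (σ B = 0 ∨ σ B = 1))
    (H : ∀ u : E → Γ, IsChirotope (initSign σ v r u) r) : CellRel v r := by
  intro u lam hb I J hI hJ j hj h1 h2
  have hw : ∀ B : Finset E, B.card = r → (lam : WithTop Γ) ≤ wsub (v B) (∑ i ∈ B, u i) := by
    intro B hB
    have := hb B hB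
    cases hv : v B with
    | top => simp [wsub]
    | coe x =>
      rw [hv] at this
      simp only [wsub, WithTop.map_coe, WithTop.coe_le_coe] at this ⊢
      exact le_sub_iff_add_le.2 this
  have ht : ∀ B : Finset E, Tight v u lam B → wsub (v B) (∑ i ∈ B, u i) = lam := by
    intro B hB
    rw [Tight] at hB
    rw [hB, wsub, WithTop.map_coe, add_sub_cancel_right]
  have hin : ∀ B : Finset E, B.card = r → Tight v u lam B → initSign σ v r u B = 1 := by
    intro B hB h
    have hne : v B ≠ ⊤ := by rw [Tight] at h; rw [h]; exact WithTop.coe_ne_top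
    rw [initSign, if_pos]
    · rcases hpos B hB with h' | h'
      · exact absurd ((hσv B hB).1 h') hne
      · exact h'
    · refine ⟨hne, fun B' hB' => ?_⟩
      rw [ht B h]; exact hw B' hB'
  have hback : ∀ B : Finset E, B.card = r → initSign σ v r u B ≠ 0 →
      Tight v u lam B ∧ initSign σ v r u B = 1 := by
    intro B hB h
    rw [initSign] at h ⊢
    split_ifs at h ⊢ with hc
    · refine ⟨?_, (hpos B hB).resolve_left h⟩
      have h3 := hc.2 _ (card_ins hI hj)
      rw [ht _ h1] at h3
      have h4 := le_antisymm h3 (hw B hB)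
      cases hv : v B with
      | top => exact absurd hv hc.1
      | coe x =>
        rw [hv] at h4
        simp only [wsub, WithTop.map_coe, WithTop.coe_inj] at h4
        rw [Tight, hv, ← h4]; simp
    · exact absurd rfl h
  have fin : ∀ j' ∈ J \ I, ∀ s : SignType, s ≠ 0 → ssign j' I J * initSign σ v r u (insert j' I) *
      initSign σ v r u (J.erase j') = s →
      Tight v u lam (insert j' I) ∧ Tight v u lam (J.erase j') ∧ ssign j' I J = s := by
    intro j' hj' s hs he
    have n1 : initSign σ v r u (insert j' I) ≠ 0 := by
      intro h; rw [h] at he; simp at he; exact hs he.symm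
    have n2 : initSign σ v r u (J.erase j') ≠ 0 := by
      intro h; rw [h] at he; simp at he; exact hs he.symm
    obtain ⟨a1, b1⟩ := hback _ (card_ins hI hj') n1
    obtain ⟨a2, b2⟩ := hback _ (card_era hJ hj') n2
    rw [b1, b2, mul_one, mul_one] at he
    exact ⟨a1, a2, he⟩
  rcases (H u).2 I J hI hJ with h | ⟨⟨x, hx, hx'⟩, ⟨y, hy, hy'⟩⟩
  · have := h j hj
    rw [hin _ (card_ins hI hj) h1, hin _ (card_era hJ hj) h2, mul_one, mul_one] at this
    rcases ssign_or j I J with h | h <;> rw [h] at this <;> exact absurd this (by decide)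
  · rcases ssign_or j I J with h | h
    · obtain ⟨a, b, c⟩ := fin y hy _ (by decide) hy'
      exact ⟨y, hy, a, b, by rw [c, h]⟩
    · obtain ⟨a, b, c⟩ := fin x hx _ (by decide) hx'
      exact ⟨x, hx, a, b, by rw [c, h]; decide⟩

/-- relation -/
def GoodRel {E Γ : Type*} [LinearOrder E] [AddCommGroup Γ] [LinearOrder Γ]
    (v : Finset E → WithTop Γ) (I J : Finset E) : Prop :=
  ∀ j ∈ J \ I, v (insert j I) + v (J.erase j) ≠ ⊤ →
    (∀ k ∈ J \ I, v (insert j I) + v (J.erase j) ≤ v (insert k I) + v (J.erase k)) →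
    ∃ j' ∈ J \ I, v (insert j' I) + v (J.erase j') = v (insert j I) + v (J.erase j) ∧
      ssign j' I J = - ssign j I J

theorem ovm_of_good {E : Type*} [Fintype E] [LinearOrder E] {Γ : Type*} [AddCommGroup Γ]
    [LinearOrder Γ] [IsOrderedAddMonoid Γ]
    (r : ℕ) (σ : Finset E → SignType) (v : Finset E → WithTop Γ)
    (hσv : ∀ B : Finset E, B.card = r → (σ B = 0 ↔ v B = ⊤))
    (hpos : ∀ B : Finset E, B.card = r → (σ B = 0 ∨ σ B = 1))
    (H : ∀ I J : Finset E, I.card + 1 = r → J.card = r + 1 → GoodRel v I J) :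
    OrientedValuatedMatroid σ v r := by
  intro I J hI hJ
  by_cases hall : ∀ j ∈ J \ I, v (insert j I) + v (J.erase j) = ⊤
  · exact Or.inl hall
  right
  push Not at hall
  obtain ⟨j0, hj0, hf0⟩ := hall
  obtain ⟨j, hj, hjm⟩ := Finset.exists_min_image (J \ I)
    (fun j => v (insert j I) + v (J.erase j)) ⟨j0, hj0⟩
  have hf : v (insert j I) + v (J.erase j) ≠ ⊤ := fun h => hf0 (top_le_iff.1 (h ▸ hjm j0 hj0))
  obtain ⟨j', hj', he, hs⟩ := H I J hI hJ j hj hf hjm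
  have hone : ∀ x ∈ J \ I, v (insert x I) + v (J.erase x) ≠ ⊤ →
      ssign x I J * σ (insert x I) * σ (J.erase x) = ssign x I J := by
    intro x hx hfx
    have hh := WithTop.add_ne_top.1 hfx
    have a1 : σ (insert x I) = 1 := (hpos _ (card_ins hI hx)).resolve_left
      fun h => hh.1 ((hσv _ (card_ins hI hx)).1 h)
    have a2 : σ (J.erase x) = 1 := (hpos _ (card_era hJ hx)).resolve_left
      fun h => hh.2 ((hσv _ (card_era hJ hx)).1 h)
    rw [a1, a2, mul_one, mul_one]
  have hjm' : ∀ k ∈ J \ I, v (insert j' I) + v (J.erase j') ≤ v (insert k I) + v (J.erase k) := by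
    rw [he]; exact hjm
  have o1 := hone j hj hf
  have o2 := hone j' hj' (by rw [he]; exact hf)
  rcases ssign_or j I J with h | h
  · exact ⟨⟨j, hj, hjm, by rw [o1, h]⟩, ⟨j', hj', hjm', by rw [o2, hs, h]⟩⟩
  · exact ⟨⟨j', hj', hjm', by rw [o2, hs, h]; decide⟩, ⟨j, hj, hjm, by rw [o1, h]⟩⟩

theorem good_of_subsingleton {E : Type*} [LinearOrder E] {Γ : Type*} [AddCommGroup Γ]
    [LinearOrder Γ] [IsOrderedAddMonoid Γ] [Subsingleton Γ]
    (r : ℕ) (v : Finset E → WithTop Γ) (H : CellRel v r)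
    (I J : Finset E) (hI : I.card + 1 = r) (hJ : J.card = r + 1) : GoodRel v I J := by
  intro j hj hf _
  have hT : ∀ B, v B ≠ ⊤ → Tight v (0 : E → Γ) 0 B := by
    intro B hB
    rw [Tight]
    cases hv : v B with
    | top => exact absurd hv hB
    | coe x => rw [Subsingleton.elim x]
  have hb : Bnd v r (0 : E → Γ) 0 := by
    intro B _
    by_cases h : v B = ⊤
    · rw [h]; exact le_top
    · exact (hT B h).ge
  have hh := WithTop.add_ne_top.1 hf
  have h1 := hT _ hh.1
  have h2 := hT _ hh.2
  obtain ⟨j', hj', t1, t2, hs⟩ := H 0 0 hb I J hI hJ j hj h1 h2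
  refine ⟨j', hj', ?_, hs⟩
  rw [Tight] at h1 h2 t1 t2
  rw [h1, h2, t1, t2]; simp

theorem forward_dir {E : Type*} [Fintype E] [LinearOrder E] {Γ : Type*} [AddCommGroup Γ]
    [LinearOrder Γ] [IsOrderedAddMonoid Γ]
    (r : ℕ) (σ : Finset E → SignType) (v : Finset E → WithTop Γ)
    (hσv : ∀ B : Finset E, B.card = r → (σ B = 0 ↔ v B = ⊤))
    (hσ : ∃ B : Finset E, B.card = r ∧ σ B ≠ 0)
    (H : OrientedValuatedMatroid σ v r) (u : E → Γ) : IsChirotope (initSign σ v r u) r := by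
  obtain ⟨B0, hB0, hs0⟩ := hσ
  have hv0 : v B0 ≠ ⊤ := fun h => hs0 ((hσv B0 hB0).2 h)
  obtain ⟨B, hB, hm⟩ := Finset.exists_min_image
    ((Finset.univ : Finset (Finset E)).filter fun B => B.card = r)
    (fun B => wsub (v B) (∑ i ∈ B, u i)) ⟨B0, by simp [hB0]⟩
  simp only [Finset.mem_filter, Finset.mem_univ, true_and] at hB hm
  have hvB : v B ≠ ⊤ := by
    intro h
    have := hm B0 hB0
    rw [h] at this
    cases hv : v B0 with
    | top => exact hv0 hv
    | coe x => rw [hv] at this; simp [wsub] at this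
  obtain ⟨b, hb⟩ := WithTop.ne_top_iff_exists.1 hvB
  set lam : Γ := b - ∑ i ∈ B, u i with hlam
  have hbd : Bnd v r u lam := by
    intro B' hB'
    have := hm B' hB'
    rw [← hb] at this
    cases hv : v B' with
    | top => exact le_top
    | coe x =>
      rw [hv] at this
      simp only [wsub, WithTop.map_coe, WithTop.coe_le_coe] at this ⊢
      exact le_sub_iff_add_le.1 this
  have hmin : ∀ B' : Finset E, B'.card = r → (Tight v u lam B' ↔
      (v B' ≠ ⊤ ∧ ∀ B'' : Finset E, B''.card = r →
      wsub (v B') (∑ i ∈ B', u i) ≤ wsub (v B'') (∑ i ∈ B'', u i))) := by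
    intro B' hB'
    constructor
    · intro h
      rw [Tight] at h
      refine ⟨by rw [h]; exact WithTop.coe_ne_top, fun B'' hB'' => ?_⟩
      refine le_trans (le_of_eq ?_) (hm B'' hB'')
      rw [h, ← hb, wsub, wsub, WithTop.map_coe, WithTop.map_coe, add_sub_cancel_right]
    · rintro ⟨h1, h2⟩
      have h3 := le_antisymm (h2 B hB) (hm B' hB')
      obtain ⟨x, hx⟩ := WithTop.ne_top_iff_exists.1 h1
      rw [← hb, ← hx] at h3
      simp only [wsub, WithTop.map_coe, WithTop.coe_inj] at h3
      rw [Tight, ← hx, hlam, ← h3]; simp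
  have hi1 : ∀ B' : Finset E, B'.card = r → Tight v u lam B' → initSign σ v r u B' = σ B' := by
    intro B' hB' h
    rw [initSign, if_pos ((hmin B' hB').1 h)]
  have hi2 : ∀ B' : Finset E, B'.card = r → initSign σ v r u B' ≠ 0 → Tight v u lam B' := by
    intro B' hB' h
    by_contra hc
    rw [initSign, if_neg (fun h' => hc ((hmin B' hB').2 h'))] at h
    exact h rfl
  have htB : Tight v u lam B := by rw [Tight, ← hb, hlam]; simp
  refine ⟨⟨B, hB, ?_⟩, ?_⟩
  · rw [hi1 B hB htB]
    exact fun h => hvB ((hσv B hB).1 h)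
  intro I J hI hJ
  by_cases hall : ∀ j ∈ J \ I, ssign j I J * initSign σ v r u (insert j I) *
      initSign σ v r u (J.erase j) = 0
  · exact Or.inl hall
  right
  push Not at hall
  obtain ⟨j, hj, hne⟩ := hall
  have t1 : Tight v u lam (insert j I) := hi2 _ (card_ins hI hj) (by
    intro h; rw [h] at hne; simp at hne)
  have t2 : Tight v u lam (J.erase j) := hi2 _ (card_era hJ hj) (by
    intro h; rw [h] at hne; simp at hne)
  have hsum : ∀ k ∈ J \ I, (lam + ∑ i ∈ insert k I, u i) + (lam + ∑ i ∈ J.erase k, u i) =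
      lam + lam + ∑ i ∈ I, u i + ∑ i ∈ J, u i := by
    intro k hk
    rw [Finset.mem_sdiff] at hk
    rw [Finset.sum_insert hk.2, ← Finset.add_sum_erase J u hk.1]
    abel
  have key : ∀ k ∈ J \ I, (v (insert k I) + v (J.erase k) ≤ v (insert j I) + v (J.erase j)) →
      Tight v u lam (insert k I) ∧ Tight v u lam (J.erase k) := by
    intro k hk hle
    have b1 := hbd _ (card_ins hI hk)
    have b2 := hbd _ (card_era hJ hk)
    rw [Tight] at t1 t2
    rw [t1, t2, ← WithTop.coe_add, hsum j hj, ← hsum k hk] at hle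
    have hft : v (insert k I) + v (J.erase k) ≠ ⊤ := fun h => by
      rw [h, top_le_iff] at hle; exact WithTop.coe_ne_top hle
    obtain ⟨f1, f2⟩ := WithTop.add_ne_top.1 hft
    obtain ⟨x, hx⟩ := WithTop.ne_top_iff_exists.1 f1
    obtain ⟨y, hy⟩ := WithTop.ne_top_iff_exists.1 f2
    rw [Tight, Tight]
    rw [← hx, ← hy] at hle
    rw [← hx] at b1 ⊢
    rw [← hy] at b2 ⊢
    rw [← WithTop.coe_add] at hle
    rw [WithTop.coe_le_coe] at hle b1 b2
    rw [WithTop.coe_inj, WithTop.coe_inj]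
    constructor
    · refine le_antisymm (le_of_not_gt fun h => ?_) b1
      exact absurd hle (not_le.2 (add_lt_add_of_lt_of_le h b2))
    · refine le_antisymm (le_of_not_gt fun h => ?_) b2
      exact absurd hle (not_le.2 (add_lt_add_of_le_of_lt b1 h))
  rcases H I J hI hJ with h | ⟨⟨x, hx, hx1, hx2⟩, ⟨y, hy, hy1, hy2⟩⟩
  · exfalso
    have := h j hj
    rw [Tight] at t1 t2
    rw [t1, t2, ← WithTop.coe_add] at this
    exact WithTop.coe_ne_top this
  · obtain ⟨a1, a2⟩ := key x hx (hx1 j hj)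
    obtain ⟨b1, b2⟩ := key y hy (hy1 j hj)
    refine ⟨⟨x, hx, ?_⟩, ⟨y, hy, ?_⟩⟩
    · rw [hi1 _ (card_ins hI hx) a1, hi1 _ (card_era hJ hx) a2, hx2]
    · rw [hi1 _ (card_ins hI hy) b1, hi1 _ (card_era hJ hy) b2, hy2]

theorem exists_bigM {E : Type*} [Fintype E] {Γ : Type*} [AddCommGroup Γ]
    [LinearOrder Γ] [IsOrderedAddMonoid Γ] [Nontrivial Γ] (w : Finset E → Γ) :
    ∃ M : Γ, 0 < M ∧ ∀ B B', w B - w B' < M := by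
  obtain ⟨M0, h0⟩ := Finite.exists_le (fun q : Finset E × Finset E => w q.1 - w q.2)
  obtain ⟨M, hM⟩ := exists_gt M0
  have : ∀ B B', w B - w B' < M := fun B B' => (h0 (B, B')).trans_lt hM
  refine ⟨M, ?_, this⟩
  have h := this ∅ ∅
  rwa [sub_self] at h

theorem exch {E : Type*} [Fintype E] [LinearOrder E] {Γ : Type*} [AddCommGroup Γ]
    [LinearOrder Γ] [IsOrderedAddMonoid Γ] [Nontrivial Γ]
    (r : ℕ) (v : Finset E → WithTop Γ) (H : CellRel v r)
    (X Y : Finset E) (hX : X.card = r) (hY : Y.card = r) (hvX : v X ≠ ⊤) (hvY : v Y ≠ ⊤)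
    (e : E) (he : e ∈ X) (heY : e ∉ Y) :
    ∃ f ∈ Y, f ∉ X ∧ v (insert f (X.erase e)) ≠ ⊤ := by
  set w : Finset E → Γ := fun B => (v B).untopD 0 with hw
  have hvw : ∀ B, v B ≠ ⊤ → v B = (w B : WithTop Γ) := by
    intro B hB
    obtain ⟨x, hx⟩ := WithTop.ne_top_iff_exists.1 hB
    simp [hw, ← hx]
  obtain ⟨M, hM0, hM⟩ := exists_bigM w
  set u' : E → Γ := fun x => if x ∈ X then M else if x ∈ Y then 0 else -(r • M) with hu'
  have hrM : 0 ≤ r • M := nsmul_nonneg hM0.le r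
  have hu'le : ∀ x, u' x ≤ M := by
    intro x; simp only [hu']; split_ifs
    · exact le_rfl
    · exact hM0.le
    · exact (neg_nonpos.2 hrM).trans hM0.le
  obtain ⟨Z, hZ, hZm⟩ := Finset.exists_min_image
    ((Finset.univ : Finset (Finset E)).filter fun B => B.card = r ∧ v B ≠ ⊤ ∧ e ∉ B)
    (fun B => w B - ∑ i ∈ B, u' i) ⟨Y, by simp [hY, hvY, heY]⟩
  simp only [Finset.mem_filter, Finset.mem_univ, true_and] at hZ hZm
  obtain ⟨hZr, hvZ, heZ⟩ := hZ
  set lam : Γ := w Z - ∑ i ∈ Z, u' i with hlam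
  have hlamY : lam ≤ w Y := by
    refine (hZm Y ⟨hY, hvY, heY⟩).trans ?_
    rw [sub_le_self_iff]
    apply Finset.sum_nonneg
    intro x hx
    simp only [hu', hx, if_true]
    split_ifs
    · exact hM0.le
    · exact le_rfl
  have hZsub : ∀ g ∈ Z, g ∉ X → g ∈ Y := by
    intro g hg hgX
    by_contra hgY
    have h1 : ∑ i ∈ Z, u' i ≤ -M := by
      rw [← Finset.add_sum_erase Z u' hg]
      have h2 : u' g = -(r • M) := by simp [hu', hgX, hgY]
      have h3 : ∑ i ∈ Z.erase g, u' i ≤ (Z.erase g).card • M :=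
        Finset.sum_le_card_nsmul _ _ _ fun x _ => hu'le x
      have h4 : (Z.erase g).card + 1 = r := by rw [Finset.card_erase_add_one hg, hZr]
      have h5 : r • M = (Z.erase g).card • M + M := by rw [← h4, add_nsmul, one_nsmul]
      rw [h2, h5]
      calc _ ≤ -((Z.erase g).card • M + M) + (Z.erase g).card • M := by gcongr
        _ = _ := by abel
    have h2 : w Z + M ≤ lam := by
      rw [hlam, sub_eq_add_neg]
      have := neg_le_neg h1
      rw [neg_neg] at this
      gcongr
    have h3 := hM Y Z
    rw [sub_lt_iff_lt_add] at h3
    exact absurd (h2.trans hlamY) (not_le.2 (by rwa [add_comm]))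
  set t : Γ := w X - lam - ∑ i ∈ X.erase e, u' i with ht
  set u : E → Γ := fun x => if x = e then t else u' x with hu
  have hue : u e = t := by simp [hu]
  have hun : ∀ B : Finset E, e ∉ B → ∑ i ∈ B, u i = ∑ i ∈ B, u' i := by
    intro B hB
    apply Finset.sum_congr rfl
    intro x hx
    have : x ≠ e := by rintro rfl; exact hB hx
    simp [hu, this]
  have hsX : lam + ∑ i ∈ X, u i = w X := by
    rw [← Finset.add_sum_erase X u he, hue, hun _ (Finset.notMem_erase e X), ht]; abel
  have tX : Tight v u lam X := by rw [Tight, hsX]; exact hvw X hvX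
  have tZ : Tight v u lam Z := by
    rw [Tight, hun Z heZ, hlam, sub_add_cancel]; exact hvw Z hvZ
  have hb : Bnd v r u lam := by
    intro B hB
    by_cases hvB : v B = ⊤
    · rw [hvB]; exact le_top
    rw [hvw B hvB, WithTop.coe_le_coe]
    by_cases heB : e ∈ B
    · by_cases hBX : B = X
      · rw [hBX, hsX]
      have hdiff : ∑ i ∈ B, u i + M ≤ ∑ i ∈ X, u i := by
        have e1 : ∑ i ∈ B, u i = ∑ i ∈ B ∩ X, u i + ∑ i ∈ B \ X, u i :=
          (Finset.sum_inter_add_sum_sdiff B X u).symm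
        have e2 : ∑ i ∈ X, u i = ∑ i ∈ B ∩ X, u i + ∑ i ∈ X \ B, u i := by
          rw [Finset.inter_comm]; exact (Finset.sum_inter_add_sum_sdiff X B u).symm
        have e3 : ∑ i ∈ B \ X, u i ≤ 0 := by
          apply Finset.sum_nonpos
          intro x hx
          rw [Finset.mem_sdiff] at hx
          have : x ≠ e := by rintro rfl; exact hx.2 he
          simp only [hu, this, if_false, hu', hx.2]
          split_ifs
          · exact le_rfl
          · exact neg_nonpos.2 hrM
        have e4 : M ≤ ∑ i ∈ X \ B, u i := by
          have hval : ∀ x ∈ X \ B, u x = M := by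
            intro x hx
            rw [Finset.mem_sdiff] at hx
            have : x ≠ e := by rintro rfl; exact hx.2 heB
            simp only [hu, this, if_false, hu', hx.1, if_true]
          obtain ⟨x, hx⟩ : (X \ B).Nonempty := by
            rw [Finset.sdiff_nonempty]
            intro h
            exact hBX (Finset.eq_of_subset_of_card_le h (by rw [hB, hX])).symm
          rw [← hval x hx]
          exact Finset.single_le_sum (fun y hy => by rw [hval y hy]; exact hM0.le) hx
        rw [e1, e2, add_assoc]
        have : ∑ i ∈ B \ X, u i + M ≤ 0 + ∑ i ∈ X \ B, u i := add_le_add e3 e4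
        rw [zero_add] at this
        gcongr
      have h3 := hM X B
      rw [← hsX] at h3
      have h4 : lam + ∑ i ∈ B, u i + M ≤ lam + ∑ i ∈ X, u i := by rw [add_assoc]; gcongr
      rw [sub_lt_iff_lt_add] at h3
      have h5 := h4.trans_lt h3
      rw [add_comm M] at h5
      exact (lt_of_add_lt_add_right h5).le
    · rw [hun B heB]
      exact le_sub_iff_add_le.1 (hZm B ⟨hB, hvB, heB⟩)
  have hcI : (X.erase e).card + 1 = r := by rw [Finset.card_erase_add_one he, hX]
  have hcJ : (insert e Z).card = r + 1 := by rw [Finset.card_insert_of_notMem heZ, hZr]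
  obtain ⟨f, hf, t1, t2, hs⟩ := H u lam hb (X.erase e) (insert e Z) hcI hcJ e (by simp)
    (by rwa [Finset.insert_erase he]) (by rwa [Finset.erase_insert heZ])
  have hfe : f ≠ e := by
    rintro rfl
    rcases ssign_or f (X.erase f) (insert f Z) with h | h <;> rw [h] at hs <;>
      exact absurd hs (by decide)
  simp only [Finset.mem_sdiff, Finset.mem_insert, hfe, false_or, Finset.mem_erase, ne_eq,
    not_false_eq_true, true_and] at hf
  refine ⟨f, hZsub f hf.1 hf.2, hf.2, ?_⟩
  rw [Tight] at t1
  rw [t1]; exact WithTop.coe_ne_top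

theorem exch_rev {E : Type*} [Fintype E] [LinearOrder E] {Γ : Type*} [AddCommGroup Γ]
    [LinearOrder Γ] [IsOrderedAddMonoid Γ] [Nontrivial Γ]
    (r : ℕ) (v : Finset E → WithTop Γ) (H : CellRel v r)
    (X Y : Finset E) (hX : X.card = r) (hY : Y.card = r) (hvX : v X ≠ ⊤) (hvY : v Y ≠ ⊤)
    (e : E) (he : e ∈ X) (heY : e ∉ Y) :
    ∃ f ∈ Y, f ∉ X ∧ v (insert e (Y.erase f)) ≠ ⊤ := by
  let P : Set E → Prop := fun B => ∃ B' : Finset E, (B' : Set E) = B ∧ B'.card = r ∧ v B' ≠ ⊤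
  obtain ⟨Mt, hE, hb⟩ : ∃ Mt : Matroid E, Mt.E = Set.univ ∧ ∀ B, Mt.IsBase B ↔ P B :=
   ⟨Matroid.ofIsBaseOfFinite (E := Set.univ) Set.finite_univ P
    ⟨X, X, rfl, hX, hvX⟩
    (by
      rintro _ _ ⟨A, rfl, hA, hvA⟩ ⟨B, rfl, hB, hvB⟩ a ha
      simp only [Set.mem_sdiff, Finset.mem_coe] at ha
      obtain ⟨f, hf, hfA, hv⟩ := exch r v H A B hA hB hvA hvB a ha.1 ha.2
      refine ⟨f, by simp [hf, hfA], insert f (A.erase a), by simp, ?_, hv⟩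
      rw [Finset.card_insert_of_notMem (by simp [hfA]), Finset.card_erase_add_one ha.1, hA])
    (fun _ _ => Set.subset_univ _), rfl, fun B => Iff.rfl⟩
  have b1 : Mt.IsBase (X : Set E) := (hb _).2 ⟨X, rfl, hX, hvX⟩
  have b2 : Mt.IsBase (Y : Set E) := (hb _).2 ⟨Y, rfl, hY, hvY⟩
  obtain ⟨f, hf, hB⟩ := b2.compl_isBase_dual.exchange b1.compl_isBase_dual (e := e)
    (by simp [he, heY, hE])
  have hB2 := hB.compl_isBase_of_dual
  rw [hE] at hB2
  simp only [hE, Set.mem_sdiff, Finset.mem_coe, Set.mem_univ, true_and, not_not] at hf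
  obtain ⟨B', hB', hc, hv⟩ := (hb _).1 hB2
  refine ⟨f, hf.2, hf.1, ?_⟩
  have : B' = insert e (Y.erase f) := by
    apply Finset.coe_injective
    have hef : e ≠ f := fun h => heY (h ▸ hf.2)
    rw [hB']; ext z; simp
    have : z = e → z ≠ f := fun h => h ▸ hef
    tauto
  rwa [← this]

theorem interval_pick {Γ : Type*} [AddCommGroup Γ] [LinearOrder Γ] [IsOrderedAddMonoid Γ]
    (x : Γ) (P Q : WithTop Γ) (h : (x : WithTop Γ) ≤ P + Q) :
    ∃ α : Γ, (α : WithTop Γ) ≤ P ∧ ((x - α : Γ) : WithTop Γ) ≤ Q := by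
  cases P with
  | coe a =>
    refine ⟨a, le_rfl, ?_⟩
    cases Q with
    | top => exact le_top
    | coe b =>
      rw [← WithTop.coe_add, WithTop.coe_le_coe] at h
      rw [WithTop.coe_le_coe]
      exact sub_le_iff_le_add'.2 h
  | top =>
    cases Q with
    | top => exact ⟨0, le_top, le_top⟩
    | coe b => exact ⟨x - b, le_top, by simp⟩

/-- weights on the octahedron -/
theorem oct_weights {Γ : Type*} [AddCommGroup Γ] [LinearOrder Γ] [IsOrderedAddMonoid Γ]
    (a b : Γ) (Ppr Pqs Pps Pqr : WithTop Γ)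
    (h1 : ((a + b : Γ) : WithTop Γ) ≤ Ppr + Pqs) (h2 : ((a + b : Γ) : WithTop Γ) ≤ Pps + Pqr) :
    ∃ lam wp wq wr ws : Γ, lam + (wp + wq) = a ∧ lam + (wr + ws) = b ∧
      ((lam + (wp + wr) : Γ) : WithTop Γ) ≤ Ppr ∧ ((lam + (wq + ws) : Γ) : WithTop Γ) ≤ Pqs ∧
      ((lam + (wp + ws) : Γ) : WithTop Γ) ≤ Pps ∧ ((lam + (wq + wr) : Γ) : WithTop Γ) ≤ Pqr := by
  obtain ⟨α, ha1, ha2⟩ := interval_pick _ _ _ h1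
  obtain ⟨γ, hb1, hb2⟩ := interval_pick _ _ _ h2
  -- γ = β + b
  refine ⟨α - (γ - b), γ - b, a - α, 0, b - α + (γ - b), by abel, by abel, ?_, ?_, ?_, ?_⟩
  · convert ha1 using 2; abel
  · convert ha2 using 2; abel
  · convert hb1 using 2; abel
  · convert hb2 using 2; abel

theorem oct_cell {E : Type*} [Fintype E] [LinearOrder E] {Γ : Type*} [AddCommGroup Γ]
    [LinearOrder Γ] [IsOrderedAddMonoid Γ] [Nontrivial Γ]
    (r : ℕ) (v : Finset E → WithTop Γ) (S : Finset E) (hS : S.card + 2 = r)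
    (Q : Finset E) (hQ : Disjoint S Q) (lam : Γ) (w : E → Γ)
    (hw : ∀ x ∈ Q, ∀ y ∈ Q, x ≠ y →
      ((lam + (w x + w y) : Γ) : WithTop Γ) ≤ v (insert x (insert y S))) :
    ∃ (u : E → Γ) (mu : Γ), Bnd v r u mu ∧ ∀ x ∈ Q, ∀ y ∈ Q, x ≠ y →
      mu + ∑ i ∈ insert x (insert y S), u i = lam + (w x + w y) := by
  set W : Γ := ∑ x ∈ Q, |w x| with hWdef
  have hW0 : 0 ≤ W := Finset.sum_nonneg fun x _ => abs_nonneg _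
  obtain ⟨N, hN⟩ := Finite.exists_le (fun B : Finset E => lam + W - (v B).untopD 0)
  obtain ⟨M, hM⟩ := exists_gt (max N 0)
  have hM0 : 0 ≤ M := (le_max_right N 0).trans hM.le
  have hMN : N ≤ M := (le_max_left N 0).trans hM.le
  set u : E → Γ := fun x => if x ∈ S then M else if x ∈ Q then w x else -M with hu
  have uS : ∀ x ∈ S, u x = M := fun x hx => by simp [hu, hx]
  have uQ : ∀ x ∈ Q, u x = w x := fun x hx => by
    have : x ∉ S := fun h => (Finset.disjoint_left.1 hQ h) hx
    simp [hu, hx, this]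
  have hsum : ∀ x ∈ Q, ∀ y ∈ Q, x ≠ y →
      lam - S.card • M + ∑ i ∈ insert x (insert y S), u i = lam + (w x + w y) := by
    intro x hx y hy hxy
    have hxS : x ∉ S := fun h => (Finset.disjoint_left.1 hQ h) hx
    have hyS : y ∉ S := fun h => (Finset.disjoint_left.1 hQ h) hy
    rw [Finset.sum_insert (by simp [hxy, hxS]), Finset.sum_insert hyS, uQ x hx, uQ y hy,
      Finset.sum_congr rfl uS, Finset.sum_const]
    abel
  refine ⟨u, lam - S.card • M, ?_, hsum⟩
  intro B hB
  by_cases hvB : v B = ⊤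
  · rw [hvB]; exact le_top
  by_cases hg : S ⊆ B ∧ B ⊆ S ∪ Q
  · have hc : (B \ S).card = 2 := by
      rw [Finset.card_sdiff_of_subset hg.1]; omega
    obtain ⟨x, y, hxy, he⟩ := Finset.card_eq_two.1 hc
    have hBe : B = insert x (insert y S) := by
      have := Finset.sdiff_union_of_subset hg.1
      rw [he] at this
      rw [← this]; ext z; simp [or_assoc]
    have hQm : ∀ z ∈ B \ S, z ∈ Q := by
      intro z hz
      rw [Finset.mem_sdiff] at hz
      exact (Finset.mem_union.1 (hg.2 hz.1)).resolve_left hz.2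
    have hx : x ∈ Q := hQm x (by rw [he]; simp)
    have hy : y ∈ Q := hQm y (by rw [he]; simp)
    rw [hBe, hsum x hx y hy hxy]
    exact hw x hx y hy hxy
  · obtain ⟨b, hb⟩ := WithTop.ne_top_iff_exists.1 hvB
    have hNB := hN B
    rw [← hb] at hNB ⊢
    simp only [WithTop.untopD_coe] at hNB
    rw [WithTop.coe_le_coe]
    have e1 : ∑ i ∈ B, u i = ∑ i ∈ B ∩ S, u i + ∑ i ∈ B \ S, u i :=
      (Finset.sum_inter_add_sum_sdiff B S u).symm
    have e2 : ∑ i ∈ B \ S, u i = ∑ i ∈ (B \ S) ∩ Q, u i + ∑ i ∈ (B \ S) \ Q, u i :=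
      (Finset.sum_inter_add_sum_sdiff (B \ S) Q u).symm
    have e3 : ∑ i ∈ B ∩ S, u i = (B ∩ S).card • M := by
      rw [Finset.sum_congr rfl (fun x hx => uS x (Finset.mem_inter.1 hx).2), Finset.sum_const]
    have e4 : ∑ i ∈ (B \ S) ∩ Q, u i ≤ W := by
      calc ∑ i ∈ (B \ S) ∩ Q, u i ≤ ∑ i ∈ (B \ S) ∩ Q, |w i| :=
            Finset.sum_le_sum fun x hx => by
              rw [uQ x (Finset.mem_inter.1 hx).2]; exact le_abs_self _
        _ ≤ W := Finset.sum_le_sum_of_subset_of_nonneg Finset.inter_subset_right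
            fun _ _ _ => abs_nonneg _
    have e5 : ∑ i ∈ (B \ S) \ Q, u i = ((B \ S) \ Q).card • (-M) := by
      rw [← Finset.sum_const]
      apply Finset.sum_congr rfl
      intro x hx
      simp only [Finset.mem_sdiff] at hx
      simp [hu, hx.1.2, hx.2]
    have e6 : (B ∩ S).card + 1 ≤ S.card + ((B \ S) \ Q).card := by
      have h1 : (B ∩ S).card ≤ S.card := Finset.card_le_card Finset.inter_subset_right
      by_contra hcon
      apply hg
      constructor
      · have : S.card ≤ (B ∩ S).card := by omega
        have := Finset.eq_of_subset_of_card_le Finset.inter_subset_right this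
        rw [← this]; exact Finset.inter_subset_left
      · have : ((B \ S) \ Q).card = 0 := by omega
        have hz := Finset.card_eq_zero.1 this
        intro x hx
        by_contra hxx
        rw [Finset.mem_union, not_or] at hxx
        have hxm : x ∈ (B \ S) \ Q := by simp [hx, hxx]
        rw [hz] at hxm
        exact absurd hxm (Finset.notMem_empty x)
    have e7 : (B ∩ S).card • M + M ≤ S.card • M + ((B \ S) \ Q).card • M := by
      have := nsmul_le_nsmul_left hM0 e6
      rwa [add_nsmul, add_nsmul, one_nsmul] at this
    rw [e1, e2, e3, e5]
    have h8 : lam + W - M ≤ b := by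
      rw [sub_le_comm]; exact hNB.trans hMN
    calc lam - S.card • M + ((B ∩ S).card • M + (∑ i ∈ (B \ S) ∩ Q, u i + ((B \ S) \ Q).card • (-M)))
        ≤ lam - S.card • M + ((B ∩ S).card • M + (W + ((B \ S) \ Q).card • (-M))) := by gcongr
      _ = lam + W - M + (((B ∩ S).card • M + M) - (S.card • M + ((B \ S) \ Q).card • M)) := by
          rw [smul_neg]; abel
      _ ≤ lam + W - M + 0 := by gcongr; exact sub_nonpos.2 e7
      _ ≤ b := by rwa [add_zero]

theorem ssign_oct {E : Type*} [LinearOrder E] (S : Finset E) (i j l m x : E)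
    (hi : i ∉ S) (hj : j ∉ S) (hl : l ∉ S) (hm : m ∉ S) (hjl : j ≠ l) (hjm : j ≠ m) (hlm : l ≠ m) :
    ssign x (insert i S) (insert j (insert l (insert m S))) =
      hsg x i * hsg x j * hsg x l * hsg x m := by
  rw [ssign_eq, Finset.prod_insert hi, Finset.prod_insert (by simp [*]),
    Finset.prod_insert (by simp [*]), Finset.prod_insert hm]
  have := prod_hsg_sq x S
  calc _ = (hsg x i * hsg x j * hsg x l * hsg x m) * ((∏ x_1 ∈ S, hsg x x_1) * (∏ x_1 ∈ S, hsg x x_1)) := by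
        ac_rfl
    _ = _ := by rw [this, mul_one]

theorem t3raw {E : Type*} [Fintype E] [LinearOrder E] {Γ : Type*} [AddCommGroup Γ]
    [LinearOrder Γ] [IsOrderedAddMonoid Γ] [Nontrivial Γ]
    (r : ℕ) (v : Finset E → WithTop Γ) (H : CellRel v r) (S : Finset E) (hS : S.card + 2 = r)
    (i j l m : E)
    (hi : i ∉ S) (hj : j ∉ S) (hl : l ∉ S) (hm : m ∉ S) (hij : i ≠ j) (hil : i ≠ l) (him : i ≠ m)
    (hjl : j ≠ l) (hjm : j ≠ m) (hlm : l ≠ m)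
    (P : E → E → WithTop Γ) (hP : ∀ x y, P x y = v (insert x (insert y S)))
    (hfin : P i j + P l m ≠ ⊤) (h1 : P i j + P l m ≤ P i l + P j m)
    (h2 : P i j + P l m ≤ P i m + P j l) :
    (P i l + P j m = P i j + P l m ∧
      hsg l i * hsg l j * hsg l m = - (hsg j i * hsg j l * hsg j m)) ∨
    (P i m + P j l = P i j + P l m ∧
      hsg m i * hsg m j * hsg m l = - (hsg j i * hsg j l * hsg j m)) := by
  have Psym : ∀ x y, P x y = P y x := fun x y => by rw [hP, hP, Finset.insert_comm]
  obtain ⟨f1, f2⟩ := WithTop.add_ne_top.1 hfin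
  obtain ⟨a, ha⟩ := WithTop.ne_top_iff_exists.1 f1
  obtain ⟨b, hb⟩ := WithTop.ne_top_iff_exists.1 f2
  rw [← ha, ← hb, ← WithTop.coe_add] at h1 h2
  obtain ⟨lam, wi, wj, wl, wm, q1, q2, q3, q4, q5, q6⟩ := oct_weights a b _ _ _ _ h1 h2
  set w : E → Γ := fun x => if x = i then wi else if x = j then wj else if x = l then wl else wm
    with hw
  have w1 : w i = wi := by simp [hw]
  have w2 : w j = wj := by simp [hw, hij.symm]
  have w3 : w l = wl := by simp [hw, hil.symm, hjl.symm]
  have w4 : w m = wm := by simp [hw, him.symm, hjm.symm, hlm.symm]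
  have r1 : ((lam + (w i + w j) : Γ) : WithTop Γ) ≤ P i j := by rw [w1, w2, q1, ha]
  have r2 : ((lam + (w l + w m) : Γ) : WithTop Γ) ≤ P l m := by rw [w3, w4, q2, hb]
  rw [← w1, ← w3] at q3
  rw [← w2, ← w4] at q4
  rw [← w1, ← w4] at q5
  rw [← w2, ← w3] at q6
  have hall : ∀ x ∈ ({i, j, l, m} : Finset E), ∀ y ∈ ({i, j, l, m} : Finset E), x ≠ y →
      ((lam + (w x + w y) : Γ) : WithTop Γ) ≤ v (insert x (insert y S)) := by
    intro x hx y hy hxy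
    rw [← hP]
    simp only [Finset.mem_insert, Finset.mem_singleton] at hx hy
    rcases hx with rfl | rfl | rfl | rfl <;> rcases hy with rfl | rfl | rfl | rfl <;>
      first
      | exact absurd rfl hxy
      | assumption
      | (rw [Psym, add_comm (w _) (w _)]; assumption)
  obtain ⟨u, mu, hbd, hval⟩ := oct_cell r v S hS {i, j, l, m}
    (by simp [hi, hj, hl, hm]) lam w hall
  have hcI : (insert i S).card + 1 = r := by rw [Finset.card_insert_of_notMem hi]; omega
  have hcJ : (insert j (insert l (insert m S))).card = r + 1 := by
    rw [Finset.card_insert_of_notMem (by simp [*]), Finset.card_insert_of_notMem (by simp [*]),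
      Finset.card_insert_of_notMem hm]; omega
  have E1 : (insert j (insert l (insert m S))).erase j = insert l (insert m S) :=
    Finset.erase_insert (by simp [*])
  have E2 : (insert j (insert l (insert m S))).erase l = insert j (insert m S) := by
    rw [Finset.insert_comm]; exact Finset.erase_insert (by simp [hjl.symm, hlm, hl])
  have E3 : (insert j (insert l (insert m S))).erase m = insert j (insert l S) := by
    rw [Finset.insert_comm l m, Finset.insert_comm j m]
    exact Finset.erase_insert (by simp [hjm.symm, hlm.symm, hm])
  have V : ∀ x ∈ ({i, j, l, m} : Finset E), ∀ y ∈ ({i, j, l, m} : Finset E), x ≠ y →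
      (Tight v u mu (insert x (insert y S)) ↔ P x y = ((lam + (w x + w y) : Γ) : WithTop Γ)) := by
    intro x hx y hy hxy
    rw [Tight, hval x hx y hy hxy, hP]
  obtain ⟨f, hf, t1, t2, hs⟩ := H u mu hbd (insert i S) (insert j (insert l (insert m S))) hcI hcJ j
    (by simp [hij.symm, hj])
    (by rw [Finset.insert_comm, V i (by simp) j (by simp) hij, w1, w2, q1, ha])
    (by rw [E1, V l (by simp) m (by simp) hlm, w3, w4, q2, hb])
  rw [ssign_oct S i j l m _ hi hj hl hm hjl hjm hlm,
    ssign_oct S i j l m _ hi hj hl hm hjl hjm hlm, hsg_self j, mul_one] at hs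
  have hfj : f ≠ j := by
    rintro rfl
    rw [hsg_self f, mul_one] at hs
    rcases hsg_or f i with h | h <;> rcases hsg_or f l with h' | h' <;>
      rcases hsg_or f m with h'' | h'' <;> rw [h, h', h''] at hs <;> exact absurd hs (by decide)
  have hab : P i j + P l m = ((a + b : Γ) : WithTop Γ) := by rw [← ha, ← hb, WithTop.coe_add]
  have hf' : f = l ∨ f = m := by
    simp only [Finset.mem_sdiff, Finset.mem_insert] at hf
    tauto
  rcases hf' with rfl | rfl
  · left
    rw [Finset.insert_comm, V i (by simp) f (by simp) hil] at t1
    rw [E2, V j (by simp) m (by simp) hjm] at t2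
    refine ⟨?_, ?_⟩
    · rw [t1, t2, hab, ← WithTop.coe_add, ← q1, ← q2, w1, w2, w3, w4]; congr 1; abel
    · rwa [hsg_self f, mul_one] at hs
  · right
    rw [Finset.insert_comm, V i (by simp) f (by simp) him] at t1
    rw [E3, V j (by simp) l (by simp) hjl] at t2
    refine ⟨?_, ?_⟩
    · rw [t1, t2, hab, ← WithTop.coe_add, ← q1, ← q2, w1, w2, w3, w4]; congr 1; abel
    · rwa [hsg_self f, mul_one] at hs

/-- cyclic-order sign -/
def cyc {E : Type*} [LinearOrder E] (i l m : E) : SignType := hsg l m * hsg l i * hsg m i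

theorem t3 {E : Type*} [Fintype E] [LinearOrder E] {Γ : Type*} [AddCommGroup Γ]
    [LinearOrder Γ] [IsOrderedAddMonoid Γ] [Nontrivial Γ]
    (r : ℕ) (v : Finset E → WithTop Γ) (H : CellRel v r) (S : Finset E) (hS : S.card + 2 = r)
    (i j l m : E)
    (hi : i ∉ S) (hj : j ∉ S) (hl : l ∉ S) (hm : m ∉ S) (hij : i ≠ j) (hil : i ≠ l) (him : i ≠ m)
    (hjl : j ≠ l) (hjm : j ≠ m) (hlm : l ≠ m)
    (P : E → E → WithTop Γ) (hP : ∀ x y, P x y = v (insert x (insert y S)))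
    (c1 : cyc i j l = -1) (c2 : cyc i l m = -1) (c3 : cyc i j m = -1) :
    P i l + P j m = min (P i j + P l m) (P i m + P j l) := by
  have Psym : ∀ x y, P x y = P y x := fun x y => by rw [hP, hP, Finset.insert_comm]
  have s1 := hsg_swap hjl
  have s2 := hsg_swap hjm
  have s3 := hsg_swap hlm
  -- j and m have the same sign, l opposite
  have sjm : hsg m i * hsg m j * hsg m l = (hsg j i * hsg j l * hsg j m) ∧
      hsg l i * hsg l j * hsg l m = - (hsg j i * hsg j l * hsg j m) := by
    rw [s1, s2, s3]
    clear s1 s2 s3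
    unfold cyc at c1 c2 c3
    generalize hsg j l = x1 at *
    generalize hsg j m = x2 at *
    generalize hsg l m = x3 at *
    generalize hsg j i = x4 at *
    generalize hsg l i = x5 at *
    generalize hsg m i = x6 at *
    revert x1 x2 x3 x4 x5 x6
    decide
  have nz : ∀ x y : E, hsg x y ≠ 0 := fun x y h => by
    rcases hsg_or x y with h' | h' <;> rw [h'] at h <;> exact absurd h (by decide)
  have nzj : hsg j i * hsg j l * hsg j m ≠ 0 := mul_ne_zero (mul_ne_zero (nz _ _) (nz _ _)) (nz _ _)
  have neg : ∀ x : SignType, x ≠ 0 → x ≠ -x := by decide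
  obtain ⟨g1, g2⟩ := sjm
  -- three raw relations
  have A := t3raw r v H S hS i j l m hi hj hl hm hij hil him hjl hjm hlm P hP
  have B := t3raw r v H S hS i l j m hi hl hj hm hil hij him hjl.symm hlm hjm P hP
  have C := t3raw r v H S hS i m j l hi hm hj hl him hij hil hjm.symm hlm.symm hjl P hP
  rw [Psym l j] at B
  rw [Psym m l, Psym m j] at C
  have g1' : hsg m i * hsg m j * hsg m l = hsg j i * hsg j m * hsg j l := by
    rw [g1]; ac_rfl
  have g3 : hsg j i * hsg j m * hsg j l = hsg j i * hsg j l * hsg j m := by ac_rfl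
  have A' : P i j + P l m ≠ ⊤ → P i j + P l m ≤ P i l + P j m → P i j + P l m ≤ P i m + P j l →
      P i l + P j m = P i j + P l m := by
    intro x y z
    rcases A x y z with h | h
    · exact h.1
    · rw [g1] at h; exact absurd h.2 (neg _ nzj)
  have C' : P i m + P j l ≠ ⊤ → P i m + P j l ≤ P i j + P l m → P i m + P j l ≤ P i l + P j m →
      P i l + P j m = P i m + P j l := by
    intro x y z
    rcases C x y z with h | h
    · rw [g1', g3] at h; exact absurd h.2 (neg _ nzj)
    · exact h.1
  have B' : P i l + P j m ≠ ⊤ → P i l + P j m ≤ P i j + P l m → P i l + P j m ≤ P i m + P j l →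
      P i j + P l m = P i l + P j m ∨ P i m + P j l = P i l + P j m := by
    intro x y z
    rcases B x y z with h | h
    · exact Or.inl h.1
    · exact Or.inr h.1
  generalize P i j + P l m = x at *
  generalize P i l + P j m = y at *
  generalize P i m + P j l = z at *
  clear A B C
  rcases le_total x z with h | h
  · rw [min_eq_left h]
    rcases le_total x y with h' | h'
    · by_cases hx : x = ⊤
      · rw [hx] at h' ⊢; exact top_le_iff.1 h'
      · exact A' hx h' h
    · by_cases hy : y = ⊤
      · rw [hy] at h' ⊢; exact (top_le_iff.1 h').symm
      · rcases B' hy h' (h'.trans h) with e | e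
        · exact e.symm
        · exact le_antisymm h' (h.trans e.le)
  · rw [min_eq_right h]
    rcases le_total z y with h' | h'
    · by_cases hx : z = ⊤
      · rw [hx] at h' ⊢; exact top_le_iff.1 h'
      · exact C' hx h h'
    · by_cases hy : y = ⊤
      · rw [hy] at h' ⊢; exact (top_le_iff.1 h').symm
      · rcases B' hy (h'.trans h) h' with e | e
        · exact le_antisymm h' (h.trans e.le)
        · exact e.symm

theorem prod_swap_hsg {E : Type*} [LinearOrder E] (t : E) {i j : E} {J : Finset E} (hi : i ∉ J)
    (hj : j ∈ J) :
    ∏ x ∈ insert i (J.erase j), hsg t x = (∏ x ∈ J, hsg t x) * (hsg t j * hsg t i) := by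
  rw [Finset.prod_insert (by simp [hi]), ← Finset.mul_prod_erase J (fun x => hsg t x) hj]
  generalize ∏ x ∈ J.erase j, hsg t x = z
  rcases hsg_or t j with h | h <;> rw [h] <;> generalize hsg t i = y <;> revert y z <;> decide

theorem ssign_swapJ {E : Type*} [LinearOrder E] (t : E) {i j : E} {I J : Finset E} (hi : i ∉ J)
    (hj : j ∈ J) :
    ssign t I (insert i (J.erase j)) = ssign t I J * (hsg t j * hsg t i) := by
  rw [ssign_eq, ssign_eq, prod_swap_hsg t hi hj]; ac_rfl

theorem ssign_swapI {E : Type*} [LinearOrder E] (t : E) {i j : E} {I J : Finset E} (hi : i ∉ I)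
    (hj : j ∈ I) :
    ssign t (insert i (I.erase j)) J = ssign t I J * (hsg t j * hsg t i) := by
  rw [ssign_eq, ssign_eq, prod_swap_hsg t hi hj]; ac_rfl

/-- cyclic key -/
def ckey {E : Type*} [LinearOrder E] (i x : E) : Bool ×ₗ E := toLex (decide (x < i), x)

theorem ckey_inj {E : Type*} [LinearOrder E] (i : E) : Function.Injective (ckey i) := by
  intro x y h
  simp only [ckey, toLex_inj, Prod.mk.injEq] at h
  exact h.2

theorem ckey_lt {E : Type*} [LinearOrder E] {i x y : E} (hxy : x ≠ y) :
    ckey i x < ckey i y ↔ cyc i x y = -1 := by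
  unfold ckey cyc hsg
  rw [Prod.Lex.toLex_lt_toLex]
  rcases lt_or_gt_of_ne hxy with h | h <;> by_cases h1 : x < i <;> by_cases h2 : y < i <;>
    simp [h, h1, h2, h.not_gt] <;> first | decide | (exact absurd (h.trans h2) h1) |
      (exact absurd (h.trans h1) h2)

theorem same_side {E : Type*} [LinearOrder E] {i j t t' : E} (ht : t ≠ j) (ht' : t' ≠ j)
    (h : ckey i t < ckey i j ↔ ckey i t' < ckey i j) :
    hsg t j * hsg t i = hsg t' j * hsg t' i := by
  rw [ckey_lt ht, ckey_lt ht'] at h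
  unfold cyc at h
  rcases hsg_or t j with h1 | h1 <;> rcases hsg_or t i with h2 | h2 <;>
    rcases hsg_or t' j with h3 | h3 <;> rcases hsg_or t' i with h4 | h4 <;>
    rcases hsg_or j i with h5 | h5 <;> rw [h1, h2, h3, h4, h5] at h <;> rw [h1, h2, h3, h4] <;>
    revert h <;> decide

theorem good_base {E : Type*} [LinearOrder E] {Γ : Type*} [AddCommGroup Γ]
    [LinearOrder Γ] [IsOrderedAddMonoid Γ]
    (r : ℕ) (v : Finset E → WithTop Γ) (I J : Finset E) (hI : I.card + 1 = r)
    (hJ : J.card = r + 1) (hIJ : I ⊆ J) : GoodRel v I J := by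
  intro l hl hf hmin
  have hc : ((J \ I).erase l).card = 1 := by
    rw [Finset.card_erase_of_mem hl, Finset.card_sdiff_of_subset hIJ]; omega
  obtain ⟨m, hm⟩ := Finset.card_eq_one.1 hc
  have hm' : m ∈ (J \ I).erase l := by rw [hm]; simp
  rw [Finset.mem_erase] at hm'
  obtain ⟨hml, hmK⟩ := hm'
  have hlI := (Finset.mem_sdiff.1 hl).2
  have hmI := (Finset.mem_sdiff.1 hmK).2
  have hJe : J = insert l (insert m I) := by
    rw [← Finset.sdiff_union_of_subset hIJ, ← Finset.insert_erase hl, hm]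
    ext z; simp
  have e1 : J.erase l = insert m I := by
    rw [hJe]; exact Finset.erase_insert (by simp [hml.symm, hlI])
  have e2 : J.erase m = insert l I := by
    rw [hJe, Finset.insert_comm]; exact Finset.erase_insert (by simp [hml, hmI])
  refine ⟨m, hmK, by rw [e1, e2, add_comm], ?_⟩
  have hs : ∀ x, ssign x I J = hsg x l * hsg x m := by
    intro x
    rw [ssign_eq, hJe, Finset.prod_insert (by simp [hml.symm, hlI]), Finset.prod_insert hmI,
      mul_assoc, mul_assoc, prod_hsg_sq, mul_one]
  rw [hs, hs, hsg_self, hsg_self, mul_one, one_mul, hsg_swap hml]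
  simp

theorem good_caseA {E : Type*} [Fintype E] [LinearOrder E] {Γ : Type*} [AddCommGroup Γ]
    [LinearOrder Γ] [IsOrderedAddMonoid Γ] [Nontrivial Γ]
    (r : ℕ) (v : Finset E → WithTop Γ) (H : CellRel v r)
    (I J : Finset E) (hI : I.card + 1 = r) (hJ : J.card = r + 1)
    (i : E) (hiI : i ∈ I) (hiJ : i ∉ J)
    (IH : ∀ j ∈ J \ I, GoodRel v I (insert i (J.erase j)))
    (a : E) (ha : a ∈ J \ I) (hfin : v (insert a I) + v (J.erase a) ≠ ⊤)
    (hmin : ∀ k ∈ J \ I, v (insert a I) + v (J.erase a) ≤ v (insert k I) + v (J.erase k))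
    (m m' : E) (hm : m ∈ J \ I) (hm' : m' ∈ J \ I) (hmm : m ≠ m')
    (hc : v (J.erase m) ≠ ⊤) (hc' : v (J.erase m') ≠ ⊤)
    (hp : v (insert i ((J.erase m).erase m')) ≠ ⊤) :
    ∃ j' ∈ J \ I, v (insert j' I) + v (J.erase j') = v (insert a I) + v (J.erase a) ∧
      ssign j' I J = - ssign a I J := by
  have hni : ∀ x ∈ J \ I, x ≠ i := by
    rintro x hx rfl; exact hiJ (Finset.mem_sdiff.1 hx).1
  have := pl_main (ckey i) (ckey_inj i) (J \ I) (fun x => v (J.erase x)) (fun x => v (insert x I))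
    (fun x y => v (insert i ((J.erase x).erase y)))
    (fun x y => by simp only [Finset.erase_right_comm]) (fun x => ssign x I J)
    ?_ ?_ a ha (by rwa [add_comm]) (fun k hk => by
      rw [add_comm, add_comm (v (J.erase k))]; exact hmin k hk)
    ⟨m, hm, m', hm', hmm, hc, hc', hp⟩
  · obtain ⟨t, ht, h1, h2⟩ := this
    exact ⟨t, ht, by rw [add_comm, h1, add_comm], h2⟩
  · intro l hl m hm n hn h1 h2
    have hlm : l ≠ m := by rintro rfl; exact lt_irrefl _ h1
    have hmn : m ≠ n := by rintro rfl; exact lt_irrefl _ h2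
    have hln : l ≠ n := by rintro rfl; exact lt_irrefl _ (h1.trans h2)
    have hlJ := (Finset.mem_sdiff.1 hl).1
    have hmJ := (Finset.mem_sdiff.1 hm).1
    have hnJ := (Finset.mem_sdiff.1 hn).1
    set S := ((J.erase l).erase m).erase n with hS
    have hSc : S.card + 2 = r := by
      have q1 : n ∈ (J.erase l).erase m := by simp [hnJ, hln.symm, hmn.symm]
      have q2 : m ∈ J.erase l := by simp [hmJ, hlm.symm]
      rw [hS, Finset.card_erase_of_mem q1, Finset.card_erase_of_mem q2,
        Finset.card_erase_of_mem hlJ, hJ]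
      have : 3 ≤ J.card := by
        have : ({l, m, n} : Finset E) ⊆ J := by
          intro x; simp; rintro (rfl | rfl | rfl) <;> assumption
        have h3 := Finset.card_le_card this
        rwa [Finset.card_eq_three.2 ⟨l, m, n, hlm, hln, hmn, rfl⟩] at h3
      omega
    have T := t3 r v H S hSc i l m n (by simp [hS, hiJ]) (by simp [hS]) (by simp [hS])
      (by simp [hS]) (hni l hl).symm (hni m hm).symm (hni n hn).symm hlm hln hmn
      (fun x y => v (insert x (insert y S))) (fun _ _ => rfl)
      ((ckey_lt hlm).1 h1) ((ckey_lt hmn).1 h2) ((ckey_lt hln).1 (h1.trans h2))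
    have g1 : J.erase m = insert l (insert n S) := by
      ext z; simp only [hS, Finset.mem_erase, Finset.mem_insert]
      by_cases z1 : z = l
      · subst z1; simp [hlm, hlJ]
      by_cases z2 : z = n
      · subst z2; simp [hmn.symm, hnJ]
      simp [z1, z2]
    have g2 : J.erase l = insert m (insert n S) := by
      ext z; simp only [hS, Finset.mem_erase, Finset.mem_insert]
      by_cases z1 : z = m
      · subst z1; simp [hlm.symm, hmJ]
      by_cases z2 : z = n
      · subst z2; simp [hln.symm, hnJ]
      simp [z1, z2]
    have g3 : J.erase n = insert l (insert m S) := by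
      ext z; simp only [hS, Finset.mem_erase, Finset.mem_insert]
      by_cases z1 : z = m
      · subst z1; simp [hmn, hmJ]
      by_cases z2 : z = l
      · subst z2; simp [hln, hlJ]
      simp [z1, z2]
    have f1 : (J.erase l).erase n = insert m S := by
      rw [hS, Finset.erase_right_comm (a := m), Finset.insert_erase]; simp [hmJ, hmn, hlm.symm]
    have f2 : (J.erase m).erase n = insert l S := by
      rw [hS, Finset.erase_right_comm (a := l), Finset.erase_right_comm (a := l),
        Finset.insert_erase]; simp [hlJ, hln, hlm]
    have f3 : (J.erase l).erase m = insert n S := by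
      rw [hS, Finset.insert_erase]; simp [hnJ, hln.symm, hmn.symm]
    show v (J.erase m) + v (insert i ((J.erase l).erase n)) =
      min (v (J.erase l) + v (insert i ((J.erase m).erase n)))
        (v (J.erase n) + v (insert i ((J.erase l).erase m)))
    rw [f1, f2, f3, g1, g2, g3, add_comm, add_comm (v (insert m (insert n S))),
      add_comm (v (insert l (insert m S)))]
    exact T
  · intro j hj t ht htj hf hmi
    obtain ⟨hjJ, hjI⟩ := Finset.mem_sdiff.1 hj
    have hK : ∀ x, x ∈ (insert i (J.erase j)) \ I ↔ x ∈ J \ I ∧ x ≠ j := by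
      intro x
      simp only [Finset.mem_sdiff, Finset.mem_insert, Finset.mem_erase]
      constructor
      · rintro ⟨rfl | h, h'⟩
        · exact absurd hiI h'
        · exact ⟨⟨h.2, h'⟩, h.1⟩
      · rintro ⟨h, h'⟩
        exact ⟨Or.inr ⟨h', h.1⟩, h.2⟩
    have hE : ∀ x ∈ J \ I, (insert i (J.erase j)).erase x = insert i ((J.erase j).erase x) := by
      intro x hx
      rw [Finset.erase_insert_of_ne (hni x hx).symm]
    obtain ⟨t', ht', q1, q2⟩ := IH j hj t ((hK t).2 ⟨ht, htj⟩) (by rwa [hE t ht]) (by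
      intro k hk
      obtain ⟨hk1, hk2⟩ := (hK k).1 hk
      rw [hE t ht, hE k hk1]
      exact hmi k hk1 hk2)
    obtain ⟨hk1, hk2⟩ := (hK t').1 ht'
    rw [hE t ht, hE t' hk1] at q1
    refine ⟨t', hk1, hk2, q1, fun hside => ?_⟩
    rw [ssign_swapJ t' hiJ hjJ, ssign_swapJ t hiJ hjJ, same_side htj hk2 hside] at q2
    rcases hsg_or t' j with h1 | h1 <;> rcases hsg_or t' i with h2 | h2 <;> rw [h1, h2] at q2 <;>
      revert q2 <;> generalize ssign t' I J = x <;> generalize ssign t I J = y <;>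
      revert x y <;> decide

theorem good_caseB {E : Type*} [Fintype E] [LinearOrder E] {Γ : Type*} [AddCommGroup Γ]
    [LinearOrder Γ] [IsOrderedAddMonoid Γ] [Nontrivial Γ]
    (r : ℕ) (v : Finset E → WithTop Γ) (H : CellRel v r)
    (I J : Finset E) (hI : I.card + 1 = r) (hJ : J.card = r + 1)
    (i : E) (hiI : i ∈ I) (hiJ : i ∉ J)
    (IH : ∀ a ∈ J \ I, GoodRel v (insert a (I.erase i)) J)
    (l : E) (hl : l ∈ J \ I) (hfin : v (insert l I) + v (J.erase l) ≠ ⊤)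
    (m : E) (hm : m ∈ J \ I) (hml : m ≠ l)
    (hC : ∀ x ∈ J \ I, v (J.erase x) ≠ ⊤ → x = l ∨ x = m) :
    ∃ j' ∈ J \ I, v (insert j' I) + v (J.erase j') = v (insert l I) + v (J.erase l) ∧
      ssign j' I J = - ssign l I J := by
  have hni : ∀ x ∈ J \ I, x ≠ i := by
    rintro x hx rfl; exact hiJ (Finset.mem_sdiff.1 hx).1
  obtain ⟨hlJ, hlI⟩ := Finset.mem_sdiff.1 hl
  obtain ⟨hmJ, hmI⟩ := Finset.mem_sdiff.1 hm
  obtain ⟨hd, hcl⟩ := WithTop.add_ne_top.1 hfin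
  set S := I.erase i with hS
  have hSc : S.card + 2 = r := by
    rw [hS, ← hI, ← Finset.card_erase_add_one hiI]
  have hIS : I = insert i S := (Finset.insert_erase hiI).symm
  have hlS : l ∉ S := fun h => hlI (Finset.mem_of_mem_erase h)
  have hmS : m ∉ S := fun h => hmI (Finset.mem_of_mem_erase h)
  have hiS : i ∉ S := Finset.notMem_erase i I
  have hlm0 : v (insert l (insert m S)) = ⊤ := by
    by_contra hne
    obtain ⟨f, hf, hfX, hv⟩ := exch_rev r v H (insert l (insert m S)) (J.erase l)
      (by rw [Finset.card_insert_of_notMem (by simp [hml.symm, hlS]),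
        Finset.card_insert_of_notMem hmS]; omega) (card_era hJ hl) hne hcl l (by simp) (by simp)
    simp only [Finset.mem_insert, not_or, Finset.mem_erase] at hf hfX
    have hfi : f ≠ i := by rintro rfl; exact hiJ hf.2
    have hfI : f ∉ I := fun h => hfX.2.2 (Finset.mem_erase.2 ⟨hfi, h⟩)
    have hfe : insert l ((J.erase l).erase f) = J.erase f := by
      rw [Finset.erase_right_comm, Finset.insert_erase]; simp [hlJ, hf.1.symm]
    rw [hfe] at hv
    rcases hC f (Finset.mem_sdiff.2 ⟨hf.2, hfI⟩) hv with h | h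
    · exact hf.1 h
    · exact hfX.2.1 h
  obtain ⟨a, haY, haX, hva⟩ := exch r v H (insert l I) (J.erase l) (card_ins hI hl)
    (card_era hJ hl) hd hcl i (by simp [hiI]) (by simp [hiJ])
  simp only [Finset.mem_insert, not_or, Finset.mem_erase] at haY haX
  have haK : a ∈ J \ I := Finset.mem_sdiff.2 ⟨haY.2, haX.2⟩
  have haS : a ∉ S := fun h => haX.2 (Finset.mem_of_mem_erase h)
  have hai := hni a haK
  have hva' : v (insert l (insert a S)) ≠ ⊤ := by
    rwa [Finset.erase_insert_of_ne (hni l hl), Finset.insert_comm] at hva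
  have ham : a ≠ m := by
    rintro rfl; exact hva' hlm0
  -- the relation at `insert a S`, `J`
  have hK : ∀ x, x ∈ J \ insert a S ↔ x ∈ J \ I ∧ x ≠ a := by
    intro x
    simp only [Finset.mem_sdiff, Finset.mem_insert, not_or, hS, Finset.mem_erase, not_and]
    constructor
    · rintro ⟨h1, h2, h3⟩
      exact ⟨⟨h1, fun h => h3 (by rintro rfl; exact hiJ h1) h⟩, h2⟩
    · rintro ⟨⟨h1, h2⟩, h3⟩
      exact ⟨h1, h3, fun _ => h2⟩
  have hlK : l ∈ J \ insert a S := (hK l).2 ⟨hl, fun h => haY.1 h.symm⟩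
  obtain ⟨x, hx, hxm⟩ := Finset.exists_min_image (J \ insert a S)
    (fun x => v (insert x (insert a S)) + v (J.erase x)) ⟨l, hlK⟩
  have hlf : v (insert l (insert a S)) + v (J.erase l) ≠ ⊤ := WithTop.add_ne_top.2 ⟨hva', hcl⟩
  have hxf : v (insert x (insert a S)) + v (J.erase x) ≠ ⊤ :=
    fun h => hlf (top_le_iff.1 (h ▸ hxm l hlK))
  obtain ⟨y, hy, hy1, hy2⟩ := IH a haK x hx hxf hxm
  have hxC := hC x ((hK x).1 hx).1 (WithTop.add_ne_top.1 hxf).2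
  have hyC := hC y ((hK y).1 hy).1 (WithTop.add_ne_top.1 (by rw [hy1]; exact hxf)).2
  have hxy : y ≠ x := by
    rintro rfl
    rcases ssign_or y (insert a S) J with h | h <;> rw [h] at hy2 <;> exact absurd hy2 (by decide)
  have hrel : v (insert m (insert a S)) + v (J.erase m) = v (insert l (insert a S)) + v (J.erase l)
      ∧ ssign m (insert a S) J = - ssign l (insert a S) J := by
    rcases hxC with rfl | rfl <;> rcases hyC with rfl | rfl
    · exact absurd rfl hxy
    · exact ⟨hy1, hy2⟩
    · exact ⟨hy1.symm, by rw [hy2, neg_neg]⟩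
    · exact absurd rfl hxy
  obtain ⟨hr1, hr2⟩ := hrel
  have hmf : v (insert m (insert a S)) ≠ ⊤ ∧ v (J.erase m) ≠ ⊤ :=
    WithTop.add_ne_top.1 (by rw [hr1]; exact hlf)
  -- octahedron
  set P : E → E → WithTop Γ := fun x y => v (insert x (insert y S)) with hP
  have Psym : ∀ x y, P x y = P y x := fun x y => by rw [hP]; simp only [Finset.insert_comm]
  have hPlm : P l m = ⊤ := hlm0
  have hPli : P l i ≠ ⊤ := by rw [hP]; simp only [← hIS]; exact hd
  have hPam : P a m ≠ ⊤ := by rw [Psym]; exact hmf.1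
  have hfinA : P l i + P a m ≠ ⊤ := WithTop.add_ne_top.2 ⟨hPli, hPam⟩
  have A := t3raw r v H S hSc l i a m hlS hiS haS hmS (hni l hl) (fun h => haY.1 h.symm) hml.symm
    hai.symm (hni m hm).symm ham P (fun _ _ => rfl)
  have B := t3raw r v H S hSc l a i m hlS haS hiS hmS (fun h => haY.1 h.symm) (hni l hl) hml.symm
    hai ham (hni m hm).symm P (fun _ _ => rfl)
  rw [hPlm] at A B
  simp only [WithTop.top_add, le_top, forall_const] at A B
  have hoct : P l a + P i m = P l i + P a m ∧
      hsg a l * hsg a i * hsg a m = -(hsg i l * hsg i a * hsg i m) := by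
    rcases le_total (P l i + P a m) (P l a + P i m) with h | h
    · rcases A hfinA h with h | h
      · exact h
      · exact absurd h.1.symm hfinA
    · have hfB : P l a + P i m ≠ ⊤ := fun h' => hfinA (top_le_iff.1 (h' ▸ h))
      rcases B hfB h with h | h
      · exact ⟨h.1.symm, by rw [h.2, neg_neg]⟩
      · exact absurd h.1.symm hfB
  obtain ⟨ho1, ho2⟩ := hoct
  refine ⟨m, hm, ?_, ?_⟩
  · have d1 : v (insert m I) = P i m := by rw [Psym, hP]; simp only [← hIS]
    have d2 : v (insert l I) = P l i := by rw [hP]; simp only [← hIS]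
    have d3 : v (insert m (insert a S)) = P a m := by rw [Psym]
    have d4 : v (insert l (insert a S)) = P l a := rfl
    rw [d3, d4] at hr1
    rw [d1, d2]
    have hPla : P l a ≠ ⊤ := hva'
    have hPim : P i m ≠ ⊤ := fun h => hfinA (by rw [← ho1, h, WithTop.add_top])
    obtain ⟨x1, e1⟩ := WithTop.ne_top_iff_exists.1 hPla
    obtain ⟨x2, e2⟩ := WithTop.ne_top_iff_exists.1 hPim
    obtain ⟨x3, e3⟩ := WithTop.ne_top_iff_exists.1 hPli
    obtain ⟨x4, e4⟩ := WithTop.ne_top_iff_exists.1 hPam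
    obtain ⟨x5, e5⟩ := WithTop.ne_top_iff_exists.1 hcl
    obtain ⟨x6, e6⟩ := WithTop.ne_top_iff_exists.1 hmf.2
    rw [← e1, ← e2, ← e3, ← e4] at ho1
    rw [← e1, ← e4, ← e5, ← e6] at hr1
    rw [← e2, ← e3, ← e5, ← e6]
    rw [← WithTop.coe_add, ← WithTop.coe_add, WithTop.coe_inj] at ho1 hr1 ⊢
    have k1 : x2 = x3 + x4 - x1 := by rw [← ho1]; abel
    have k2 : x6 = x1 + x5 - x4 := by rw [← hr1]; abel
    rw [k1, k2]; abel
  · have haI : a ∉ I := haX.2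
    rw [hS, ssign_swapI m haI hiI, ssign_swapI l haI hiI] at hr2
    have w1 := hsg_swap (fun h => haY.1 h.symm : l ≠ a)
    have w2 := hsg_swap ham.symm
    have w3 := hsg_swap (hni l hl)
    have w4 := hsg_swap (hni m hm)
    have w5 := hsg_swap hai
    rw [w1, w2, w3, w4, w5] at ho2
    rcases hsg_or l a with h1 | h1 <;> rcases hsg_or m a with h2 | h2 <;>
      rcases hsg_or l i with h3 | h3 <;> rcases hsg_or m i with h4 | h4 <;>
      rcases hsg_or a i with h5 | h5 <;> rw [h1, h2, h3, h4, h5] at ho2 <;>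
      first
      | exact absurd ho2 (by decide)
      | (rw [h1, h2, h3, h4] at hr2
         revert hr2; generalize ssign m I J = x; generalize ssign l I J = y
         revert x y; decide)

theorem good_all {E : Type*} [Fintype E] [LinearOrder E] {Γ : Type*} [AddCommGroup Γ]
    [LinearOrder Γ] [IsOrderedAddMonoid Γ] [Nontrivial Γ]
    (r : ℕ) (v : Finset E → WithTop Γ) (H : CellRel v r) (n : ℕ) :
    ∀ (I J : Finset E), I.card + 1 = r → J.card = r + 1 → (I \ J).card = n → GoodRel v I J := by
  induction n using Nat.strong_induction_on with
  | _ n IH =>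
  intro I J hI hJ hn
  by_cases hIJ : I ⊆ J
  · exact good_base r v I J hI hJ hIJ
  intro l hl hfin hmin
  obtain ⟨hlJ, hlI⟩ := Finset.mem_sdiff.1 hl
  obtain ⟨hd, hcl⟩ := WithTop.add_ne_top.1 hfin
  have IH1 : ∀ i ∈ I, i ∉ J → ∀ j ∈ J \ I, GoodRel v I (insert i (J.erase j)) := by
    intro i hi hiJ j hj
    obtain ⟨hjJ, hjI⟩ := Finset.mem_sdiff.1 hj
    refine IH _ ?_ _ _ hI ?_ rfl
    · rw [← hn]
      apply Finset.card_lt_card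
      rw [Finset.ssubset_iff_of_subset]
      · exact ⟨i, by simp [hi, hiJ], by simp⟩
      · intro x hx
        simp only [Finset.mem_sdiff, Finset.mem_insert, Finset.mem_erase, not_or, not_and] at hx ⊢
        refine ⟨hx.1, fun h => hx.2.2 ?_ h⟩
        rintro rfl; exact hjI hx.1
    · rw [Finset.card_insert_of_notMem (by simp [hiJ]), Finset.card_erase_add_one hjJ, hJ]
  have IH2 : ∀ i ∈ I, i ∉ J → ∀ a ∈ J \ I, GoodRel v (insert a (I.erase i)) J := by
    intro i hi hiJ a ha
    obtain ⟨haJ, haI⟩ := Finset.mem_sdiff.1 ha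
    refine IH _ ?_ _ _ ?_ hJ rfl
    · rw [← hn]
      apply Finset.card_lt_card
      rw [Finset.ssubset_iff_of_subset]
      · refine ⟨i, by simp [hi, hiJ], ?_⟩
        have : i ≠ a := by rintro rfl; exact hiJ haJ
        simp [this]
      · intro x hx
        simp only [Finset.mem_sdiff, Finset.mem_insert, Finset.mem_erase] at hx ⊢
        refine ⟨?_, hx.2⟩
        rcases hx.1 with rfl | h
        · exact absurd haJ hx.2
        · exact h.2
    · rw [Finset.card_insert_of_notMem (by simp [haI]), Finset.card_erase_add_one hi, hI]
  obtain ⟨m, hmY, hmX, hvm⟩ := exch_rev r v H (insert l I) (J.erase l) (card_ins hI hl)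
    (card_era hJ hl) hd hcl l (by simp) (by simp)
  simp only [Finset.mem_insert, not_or, Finset.mem_erase] at hmY hmX
  have hfe : insert l ((J.erase l).erase m) = J.erase m := by
    rw [Finset.erase_right_comm, Finset.insert_erase]; simp [hlJ, hmY.1.symm]
  rw [hfe] at hvm
  have hm : m ∈ J \ I := Finset.mem_sdiff.2 ⟨hmY.2, hmX.2⟩
  by_cases hA : ∃ m' ∈ J \ I, v (J.erase m') ≠ ⊤ ∧ m' ≠ l ∧ m' ≠ m
  · obtain ⟨m', hm', hv', hl', hmm⟩ := hA
    obtain ⟨hmJ', hmI'⟩ := Finset.mem_sdiff.1 hm'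
    obtain ⟨i, hiY, hiX, hvi⟩ := exch r v H (J.erase m') (insert l I) (card_era hJ hm')
      (card_ins hI hl) hv' hd m (by simp [hmY.2, hmm.symm]) (by simp [hmX])
    have hil : i ≠ l := by rintro rfl; exact hiX (by simp [hlJ, hl'.symm])
    have hiI : i ∈ I := (Finset.mem_insert.1 hiY).resolve_left hil
    have him : i ≠ m' := by rintro rfl; exact hmI' hiI
    have hiJ : i ∉ J := fun h => hiX (Finset.mem_erase.2 ⟨him, h⟩)
    exact good_caseA r v H I J hI hJ i hiI hiJ (IH1 i hiI hiJ) l hl hfin hmin m' m hm' hm hmm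
      hv' hvm hvi
  · push Not at hA
    obtain ⟨i, hi, hiJ⟩ := Finset.not_subset.1 hIJ
    refine good_caseB r v H I J hI hJ i hi hiJ (IH2 i hi hiJ) l hl hfin m hm hmY.1 ?_
    intro x hx hvx
    by_cases h : x = l
    · exact Or.inl h
    · exact Or.inr (hA x hx hvx h)

/-- Let `(σ, v)` be a signed tropical Plücker function of rank `r` with `σ`
nonnegative (taking values in `{0, +1}` on `r`-subsets). Then `(σ, v)` is an oriented valuated
matroid (an `𝕊[Γ]`-positroid) iff for every `u : E → Γ` the initial sign function `σ^u` is a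
chirotope; moreover each `σ^u` automatically takes values in `{0, +1}` on `r`-subsets, i.e. is
positively oriented. -/
theorem positroid_iff_forall_initial_chirotope
    {E : Type*} [Fintype E] [LinearOrder E] {Γ : Type*} [AddCommGroup Γ] [LinearOrder Γ] [IsOrderedAddMonoid Γ]
    (r : ℕ) (σ : Finset E → SignType) (v : Finset E → WithTop Γ)
    (hσv : ∀ B : Finset E, B.card = r → (σ B = 0 ↔ v B = ⊤))
    (hσ : ∃ B : Finset E, B.card = r ∧ σ B ≠ 0)
    (hpos : ∀ B : Finset E, B.card = r → (σ B = 0 ∨ σ B = 1)) :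
    (OrientedValuatedMatroid σ v r ↔
      ∀ u : E → Γ, IsChirotope (initSign σ v r u) r) ∧
    (∀ u : E → Γ, ∀ B : Finset E, B.card = r →
      (initSign σ v r u B = 0 ∨ initSign σ v r u B = 1)) := by
  refine ⟨⟨fun H u => forward_dir r σ v hσv hσ H u, fun H => ?_⟩, fun u B hB => ?_⟩
  · have hc := cell_of_chirotope r σ v hσv hpos H
    refine ovm_of_good r σ v hσv hpos fun I J hI hJ => ?_
    rcases subsingleton_or_nontrivial Γ with h | h
    · exact good_of_subsingleton r v hc I J hI hJ
    · exact good_all r v hc _ I J hI hJ rfl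
  · unfold initSign
    split_ifs
    · exact hpos B hB
    · exact Or.inl rfl
end

section
/- Let P be a valuated matroid of rank r on a finite set E with values in a linearly ordered abelian group Γ, and let u : E → Γ. Then the initial system 𝓑^u(P) is the set of bases of a matroid M^u on E, and moreover: (i) the circuits of M^u are exactly the inclusion-minimal sets among the initial supports supp(C, u), where C ranges over the valuated circuits of P; (ii) the cocircuits of M^u are exactly the inclusion-minimal sets among the initial supports supp(D, −u), where D ranges over the valuated cocircuits of P. -/
open scoped Classical

/-- The tropical Plücker relations for `P : binom(E,r) → Γ ∪ {∞}`: for every `(r-1)`-subset `I`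
and `(r+1)`-subset `J`, the minimum over `j ∈ J ∖ I` of `P(I∪{j}) + P(J∖{j})` is either `∞`
or attained at least twice. -/
def TropPlucker {E : Type*} [Fintype E] [DecidableEq E]
    {Γ : Type*} [AddCommGroup Γ] [LinearOrder Γ] [IsOrderedAddMonoid Γ] (P : Finset E → WithTop Γ) (r : ℕ) : Prop :=
  ∀ I J : Finset E, I.card + 1 = r → J.card = r + 1 →
    ∀ j ∈ J \ I,
      (∀ k ∈ J \ I, P (insert j I) + P (J.erase j) ≤ P (insert k I) + P (J.erase k)) →
      P (insert j I) + P (J.erase j) = ⊤ ∨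
        ∃ j' ∈ J \ I, j' ≠ j ∧ P (insert j' I) + P (J.erase j') = P (insert j I) + P (J.erase j)

/-- `B` belongs to the initial system `𝓑^u(P)`: it is an `r`-subset with `P(B) ≠ ∞` on which
`P(B) - ∑_{i∈B} u_i` is minimal among all `r`-subsets. -/
def InitBasis {E : Type*} [Fintype E] {Γ : Type*} [AddCommGroup Γ] [LinearOrder Γ] [IsOrderedAddMonoid Γ]
    (P : Finset E → WithTop Γ) (r : ℕ) (u : E → Γ) (B : Finset E) : Prop :=
  B.card = r ∧ P B ≠ ⊤ ∧ ∀ B' : Finset E, B'.card = r →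
    wsub (P B) (∑ i ∈ B, u i) ≤ wsub (P B') (∑ i ∈ B', u i)

/-- The valuated vector `C_τ` associated to an `(r+1)`-subset `τ`: `(C_τ)_i = P(τ∖{i})` for
`i ∈ τ`, and `∞` otherwise. -/
def circVec {E : Type*} [DecidableEq E] {Γ : Type*} [AddCommGroup Γ] [LinearOrder Γ] [IsOrderedAddMonoid Γ]
    (P : Finset E → WithTop Γ) (τ : Finset E) : E → WithTop Γ :=
  fun i => if i ∈ τ then P (τ.erase i) else ⊤

/-- The dual function `P*(I) = P(E ∖ I)`. -/
def dualFn {E : Type*} [Fintype E] [DecidableEq E] {Γ : Type*} [AddCommGroup Γ] [LinearOrder Γ] [IsOrderedAddMonoid Γ]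
    (P : Finset E → WithTop Γ) : Finset E → WithTop Γ :=
  fun I => P Iᶜ

/-- The initial support `supp(C, w) = {i : C_i ≠ ∞ and C_i + w_i is minimal}`. -/
def initSupp {E : Type*} {Γ : Type*} [AddCommGroup Γ] [LinearOrder Γ] [IsOrderedAddMonoid Γ]
    (C : E → WithTop Γ) (w : E → Γ) : Set E :=
  {i | C i ≠ ⊤ ∧ ∀ j, C i + (w i : WithTop Γ) ≤ C j + (w j : WithTop Γ)}

section Helpers

variable {E : Type*} [Fintype E] [DecidableEq E] {Γ : Type*} [AddCommGroup Γ] [LinearOrder Γ]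
  [IsOrderedAddMonoid Γ]

/-- The reweighted Plücker function. -/
def twist (P : Finset E → WithTop Γ) (u : E → Γ) : Finset E → WithTop Γ :=
  fun B => P B + ((-∑ i ∈ B, u i : Γ) : WithTop Γ)

theorem wsub_eq_twist (P : Finset E → WithTop Γ) (u : E → Γ) (B : Finset E) :
    wsub (P B) (∑ i ∈ B, u i) = twist P u B := by
  unfold wsub twist
  cases h : P B with
  | top => simp
  | coe a =>
    rw [WithTop.map_coe, ← WithTop.coe_add, sub_eq_add_neg]

theorem twist_ne_top (P : Finset E → WithTop Γ) (u : E → Γ) (B : Finset E) :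
    twist P u B ≠ ⊤ ↔ P B ≠ ⊤ := by
  unfold twist
  simp [WithTop.add_eq_top]

theorem initBasis_iff (P : Finset E → WithTop Γ) (r : ℕ) (u : E → Γ) (B : Finset E) :
    InitBasis P r u B ↔ B.card = r ∧ twist P u B ≠ ⊤ ∧
      ∀ B' : Finset E, B'.card = r → twist P u B ≤ twist P u B' := by
  unfold InitBasis
  simp only [wsub_eq_twist, twist_ne_top]

theorem twist_pair (P : Finset E → WithTop Γ) (u : E → Γ) (I J : Finset E) (j : E)
    (hj : j ∈ J \ I) :
    twist P u (insert j I) + twist P u (J.erase j) =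
      (P (insert j I) + P (J.erase j)) + ((-(∑ i ∈ I, u i + ∑ i ∈ J, u i) : Γ) : WithTop Γ) := by
  rw [Finset.mem_sdiff] at hj
  have h1 : (-(∑ i ∈ I, u i + ∑ i ∈ J, u i) : Γ)
      = (-∑ i ∈ insert j I, u i) + (-∑ i ∈ J.erase j, u i) := by
    rw [Finset.sum_insert hj.2, ← Finset.add_sum_erase J u hj.1]
    abel
  rw [h1, WithTop.coe_add]
  unfold twist
  exact add_add_add_comm _ _ _ _

theorem add_coe_le_iff (x y : WithTop Γ) (g : Γ) :
    x + (g : WithTop Γ) ≤ y + (g : WithTop Γ) ↔ x ≤ y :=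
  WithTop.add_le_add_iff_right (WithTop.coe_ne_top)

theorem add_coe_inj (x y : WithTop Γ) (g : Γ) :
    x + (g : WithTop Γ) = y + (g : WithTop Γ) ↔ x = y := by
  simp only [le_antisymm_iff, add_coe_le_iff]

theorem TropPlucker.twist {P : Finset E → WithTop Γ} {r : ℕ} (h : TropPlucker P r) (u : E → Γ) :
    TropPlucker (twist P u) r := by
  intro I J hI hJ j hj hmin
  have := h I J hI hJ j hj (fun k hk => by
    have := hmin k hk
    rwa [twist_pair P u I J j hj, twist_pair P u I J k hk, add_coe_le_iff] at this)
  rcases this with h1 | ⟨j', hj', hne, he⟩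
  · left
    rw [twist_pair P u I J j hj, h1, WithTop.top_add]
  · right
    refine ⟨j', hj', hne, ?_⟩
    rw [twist_pair P u I J j hj, twist_pair P u I J j' hj', he]

theorem circ_twist (P : Finset E → WithTop Γ) (u : E → Γ) (τ : Finset E) (i : E) (hi : i ∈ τ) :
    circVec P τ i + (u i : WithTop Γ)
      = _root_.twist P u (τ.erase i) + ((∑ k ∈ τ, u k : Γ) : WithTop Γ) := by
  unfold circVec _root_.twist
  rw [if_pos hi, add_assoc, ← WithTop.coe_add, ← Finset.add_sum_erase τ u hi]
  congr 2
  abel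

theorem mem_initSupp_iff (P : Finset E → WithTop Γ) (u : E → Γ) (τ : Finset E) (i : E) :
    i ∈ initSupp (circVec P τ) u ↔ i ∈ τ ∧ twist P u (τ.erase i) ≠ ⊤ ∧
      ∀ j ∈ τ, twist P u (τ.erase i) ≤ twist P u (τ.erase j) := by
  unfold initSupp
  simp only [Set.mem_ofPred_eq]
  by_cases hi : i ∈ τ
  · have h0 : circVec P τ i = P (τ.erase i) := by simp [circVec, hi]
    rw [twist_ne_top, h0]
    simp only [hi, true_and]
    refine and_congr_right fun _ => ?_
    rw [← h0, circ_twist P u τ i hi]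
    constructor
    · intro h j hj
      have := h j
      rwa [circ_twist P u τ j hj, add_coe_le_iff] at this
    · intro h j
      by_cases hj : j ∈ τ
      · rw [circ_twist P u τ j hj, add_coe_le_iff]
        exact h j hj
      · simp [circVec, hj]
  · simp [circVec, hi]

/-- Equality in a sum of two lower bounds. -/
theorem eq_of_add_eq {a b x y : WithTop Γ} (ha : a ≠ ⊤) (hb : b ≠ ⊤) (hax : a ≤ x) (hby : b ≤ y)
    (h : x + y = a + b) : x = a ∧ y = b := by
  lift a to Γ using ha
  lift b to Γ using hb
  have hx : x ≠ ⊤ := by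
    rintro rfl
    rw [WithTop.top_add, ← WithTop.coe_add] at h
    exact WithTop.coe_ne_top h.symm
  have hy : y ≠ ⊤ := by
    rintro rfl
    rw [WithTop.add_top, ← WithTop.coe_add] at h
    exact WithTop.coe_ne_top h.symm
  lift x to Γ using hx
  lift y to Γ using hy
  norm_cast at *
  constructor
  · refine le_antisymm ?_ hax
    by_contra hc
    exact absurd h (ne_of_gt (add_lt_add_of_lt_of_le (not_le.1 hc) hby))
  · refine le_antisymm ?_ hby
    by_contra hc
    exact absurd h (ne_of_gt (add_lt_add_of_le_of_lt hax (not_le.1 hc)))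

theorem exists_initBasis (P : Finset E → WithTop Γ) (r : ℕ)
    (hP : ∃ B : Finset E, B.card = r ∧ P B ≠ ⊤) (u : E → Γ) : ∃ B, InitBasis P r u B := by
  obtain ⟨B₀, h₀, hB₀⟩ := hP
  obtain ⟨B, hB, hmin⟩ := Finset.exists_min_image
    (Finset.univ.filter fun B : Finset E => B.card = r) (twist P u) ⟨B₀, by simp [h₀]⟩
  simp only [Finset.mem_filter, Finset.mem_univ, true_and] at hB hmin
  refine ⟨B, (initBasis_iff _ _ _ _).2 ⟨hB, ?_, hmin⟩⟩
  exact ne_top_of_le_ne_top ((twist_ne_top P u B₀).2 hB₀) (hmin B₀ h₀)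

theorem initBasis_exchange {P : Finset E → WithTop Γ} {r : ℕ} (hpl : TropPlucker P r) (u : E → Γ)
    {B B' : Finset E} (hB : InitBasis P r u B) (hB' : InitBasis P r u B') {e : E} (he : e ∈ B)
    (he' : e ∉ B') : ∃ f ∈ B', f ∉ B ∧ InitBasis P r u (insert f (B.erase e)) := by
  rw [initBasis_iff] at hB hB'
  obtain ⟨hc, ht, hm⟩ := hB
  obtain ⟨hc', ht', hm'⟩ := hB'
  have hI : (B.erase e).card + 1 = r := by rw [Finset.card_erase_add_one he, hc]
  have hJ : (insert e B').card = r + 1 := by rw [Finset.card_insert_of_notMem he', hc']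
  have key : ∀ k ∈ insert e B' \ B.erase e, (insert k (B.erase e)).card = r ∧
      ((insert e B').erase k).card = r := by
    intro k hk
    rw [Finset.mem_sdiff] at hk
    rw [Finset.card_insert_of_notMem hk.2, Finset.card_erase_of_mem hk.1]
    omega
  have := hpl.twist u (B.erase e) (insert e B') hI hJ e (by simp) (by
    intro k hk
    rw [Finset.insert_erase he, Finset.erase_insert he']
    exact add_le_add (hm _ (key k hk).1) (hm' _ (key k hk).2))
  rw [Finset.insert_erase he, Finset.erase_insert he'] at this
  rcases this with h | ⟨f, hf, hfe, h⟩
  · rw [WithTop.add_eq_top] at h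
    tauto
  · have h2 := (eq_of_add_eq ht ht' (hm _ (key f hf).1) (hm' _ (key f hf).2) h).1
    refine ⟨f, ?_, ?_, ?_⟩
    · simp only [Finset.mem_sdiff, Finset.mem_insert] at hf
      tauto
    · simp only [Finset.mem_sdiff, Finset.mem_erase] at hf
      tauto
    · rw [initBasis_iff, h2]
      exact ⟨(key f hf).1, ht, hm⟩

/-- Initial supports of valuated circuits are never contained in an initial basis. -/
theorem not_initSupp_subset {P : Finset E → WithTop Γ} {r : ℕ} (hpl : TropPlucker P r) (u : E → Γ)
    {B τ : Finset E} (hB : InitBasis P r u B) (hτ : τ.card = r + 1)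
    (hne : ∃ i ∈ τ, P (τ.erase i) ≠ ⊤) : ¬ initSupp (circVec P τ) u ⊆ (B : Set E) := by
  intro hsub
  obtain ⟨i₀, hi₀, hP₀⟩ := hne
  obtain ⟨i, hi, hmin⟩ := Finset.exists_min_image τ (fun i => twist P u (τ.erase i)) ⟨i₀, hi₀⟩
  have hit : twist P u (τ.erase i) ≠ ⊤ :=
    ne_top_of_le_ne_top ((twist_ne_top P u _).2 hP₀) (hmin i₀ hi₀)
  have hiB : i ∈ B := hsub ((mem_initSupp_iff P u τ i).2 ⟨hi, hit, hmin⟩)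
  rw [initBasis_iff] at hB
  obtain ⟨hc, ht, hm⟩ := hB
  have hI : (B.erase i).card + 1 = r := by rw [Finset.card_erase_add_one hiB, hc]
  have key : ∀ k ∈ τ \ B.erase i, (insert k (B.erase i)).card = r := by
    intro k hk
    rw [Finset.mem_sdiff] at hk
    rw [Finset.card_insert_of_notMem hk.2, hI]
  have := hpl.twist u (B.erase i) τ hI hτ i (by simp [hi]) (by
    intro k hk
    rw [Finset.insert_erase hiB]
    exact add_le_add (hm _ (key k hk)) (hmin k (Finset.mem_sdiff.1 hk).1))
  rw [Finset.insert_erase hiB] at this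
  rcases this with h | ⟨f, hf, hfe, h⟩
  · rw [WithTop.add_eq_top] at h
    tauto
  · have hfτ := (Finset.mem_sdiff.1 hf).1
    have h2 := (eq_of_add_eq ht hit (hm _ (key f hf)) (hmin f hfτ) h).2
    have hfB : f ∈ B := hsub ((mem_initSupp_iff P u τ f).2 ⟨hfτ, by rw [h2]; exact ⟨hit, hmin⟩⟩)
    simp [hfB, hfe] at hf

theorem circuits_aux {P : Finset E → WithTop Γ} {r : ℕ} (hpl : TropPlucker P r) (u : E → Γ)
    (M : Matroid E) (hE : M.E = Set.univ)
    (hM : ∀ B : Finset E, M.IsBase ↑B ↔ InitBasis P r u B) (C : Set E) :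
    Minimal M.Dep C ↔
        Minimal (fun S : Set E => ∃ τ : Finset E, τ.card = r + 1 ∧
          (∃ i ∈ τ, P (τ.erase i) ≠ ⊤) ∧ S = initSupp (circVec P τ) u) C := by
  have hdep : ∀ S : Set E, (∃ τ : Finset E, τ.card = r + 1 ∧
      (∃ i ∈ τ, P (τ.erase i) ≠ ⊤) ∧ S = initSupp (circVec P τ) u) → M.Dep S := by
    rintro S ⟨τ, hτ, hne, rfl⟩
    refine ⟨?_, by rw [hE]; exact Set.subset_univ _⟩
    intro hind
    obtain ⟨B, hB, hsub⟩ := hind.exists_isBase_superset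
    have hB' : M.IsBase ↑(B.toFinset) := by simpa using hB
    exact not_initSupp_subset hpl u ((hM _).1 hB') hτ hne (by simpa using hsub)
  have hcirc : ∀ S : Set E, Minimal M.Dep S → ∃ τ : Finset E, τ.card = r + 1 ∧
      (∃ i ∈ τ, P (τ.erase i) ≠ ⊤) ∧ S = initSupp (circVec P τ) u := by
    intro S hS
    obtain ⟨e, he⟩ : S.Nonempty := hS.prop.nonempty
    have hind : M.Indep (S \ {e}) := by
      by_contra hc
      have hd : M.Dep (S \ {e}) := ⟨hc, by rw [hE]; exact Set.subset_univ _⟩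
      exact (hS.le_of_le hd Set.sdiff_subset he).2 rfl
    obtain ⟨B₀, hB₀, hsub⟩ := hind.exists_isBase_superset
    obtain ⟨B, rfl⟩ : ∃ B : Finset E, (B : Set E) = B₀ := ⟨B₀.toFinset, by simp⟩
    have hB := (hM B).1 hB₀
    have heB : e ∉ B := by
      intro heB
      refine hS.prop.not_indep (hB₀.indep.subset fun x hx => ?_)
      by_cases hxe : x = e
      · subst hxe; exact heB
      · exact hsub ⟨hx, hxe⟩
    have hSτ : ∀ x ∈ S, x ∈ insert e B := by
      intro x hx
      by_cases hxe : x = e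
      · simp [hxe]
      · exact Finset.mem_insert_of_mem (hsub ⟨hx, hxe⟩)
    have hBi := (initBasis_iff P r u B).1 hB
    have hτ : (insert e B).card = r + 1 := by rw [Finset.card_insert_of_notMem heB, hB.1]
    have hF : ∃ τ : Finset E, τ.card = r + 1 ∧
        (∃ i ∈ τ, P (τ.erase i) ≠ ⊤) ∧
        initSupp (circVec P (insert e B)) u = initSupp (circVec P τ) u :=
      ⟨insert e B, hτ, ⟨e, by simp, by rw [Finset.erase_insert heB]; exact hB.2.1⟩, rfl⟩
    have hsubS : initSupp (circVec P (insert e B)) u ⊆ S := by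
      intro i hi
      rw [mem_initSupp_iff] at hi
      by_contra hiS
      have hib : InitBasis P r u ((insert e B).erase i) := by
        rw [initBasis_iff]
        refine ⟨by rw [Finset.card_erase_of_mem hi.1, hτ]; simp, hi.2.1, fun B' hB' => ?_⟩
        have := hi.2.2 e (by simp)
        rw [Finset.erase_insert heB] at this
        exact this.trans (hBi.2.2 B' hB')
      refine hS.prop.not_indep (((hM _).2 hib).indep.subset fun x hx => ?_)
      have hxi : x ≠ i := by rintro rfl; exact hiS hx
      exact Finset.mem_erase.2 ⟨hxi, hSτ x hx⟩
    have heq : S = initSupp (circVec P (insert e B)) u :=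
      Set.Subset.antisymm (hS.le_of_le (hdep _ hF) hsubS) hsubS
    rw [heq]
    exact hF
  constructor
  · intro h
    exact ⟨hcirc C h, fun S hS hle => h.le_of_le (hdep S hS) hle⟩
  · intro h
    refine ⟨hdep C h.prop, fun S hS hle => ?_⟩
    obtain ⟨S', hS', hmin⟩ := exists_minimal_le_of_wellFoundedLT M.Dep S hS
    exact (h.le_of_le (hcirc S' hmin) (hS'.trans hle)).trans hS'

theorem TropPlucker.dual {P : Finset E → WithTop Γ} {r : ℕ} (h : TropPlucker P r)
    (hr : r ≤ Fintype.card E) : TropPlucker (dualFn P) (Fintype.card E - r) := by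
  intro I J hI hJ j hj hmin
  have hsd : Iᶜ \ Jᶜ = J \ I := by
    ext x; simp [and_comm]
  have hpair : ∀ k, dualFn P (insert k I) + dualFn P (J.erase k)
      = P (insert k Jᶜ) + P (Iᶜ.erase k) := by
    intro k
    unfold dualFn
    rw [add_comm]
    congr 2
    · ext x; simp
    · ext x; simp
  have hJle : J.card ≤ Fintype.card E := Finset.card_le_univ J
  have := h Jᶜ Iᶜ (by rw [Finset.card_compl]; omega) (by rw [Finset.card_compl]; omega) j
    (by rw [hsd]; exact hj)
    (by
      intro k hk
      rw [← hpair, ← hpair]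
      exact hmin k (by rwa [hsd] at hk))
  rw [hsd] at this
  simpa only [hpair] using this

theorem twist_dual (P : Finset E → WithTop Γ) (u : E → Γ) (B : Finset E) :
    _root_.twist (dualFn P) (fun i => - u i) B
      = _root_.twist P u Bᶜ + ((∑ i, u i : Γ) : WithTop Γ) := by
  unfold _root_.twist dualFn
  rw [add_assoc, ← WithTop.coe_add, ← Finset.sum_add_sum_compl B u]
  congr 2
  rw [Finset.sum_neg_distrib]
  abel

theorem initBasis_dual (P : Finset E → WithTop Γ) (r : ℕ) (hr : r ≤ Fintype.card E) (u : E → Γ)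
    (B : Finset E) :
    InitBasis (dualFn P) (Fintype.card E - r) (fun i => - u i) B ↔ InitBasis P r u Bᶜ := by
  have hcard : ∀ A : Finset E, A.card = Fintype.card E - r ↔ Aᶜ.card = r := by
    intro A
    have := Finset.card_le_univ A
    rw [Finset.card_compl]
    omega
  rw [initBasis_iff, initBasis_iff, hcard, twist_ne_top, twist_ne_top]
  simp only [twist_dual, add_coe_le_iff, hcard]
  refine and_congr_right fun _ => and_congr Iff.rfl ⟨fun h B' hB' => ?_, fun h B' hB' => h _ hB'⟩
  have := h B'ᶜ (by rwa [compl_compl])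
  rwa [compl_compl] at this

end Helpers

/-- For a valuated matroid `P` of rank `r` and `u : E → Γ`, the initial system
`𝓑^u(P)` is the set of bases of a matroid `M^u` on `E`; the circuits of `M^u` (its minimal
dependent sets) are exactly the inclusion-minimal initial supports `supp(C, u)` of valuated
circuits `C` of `P`, and the cocircuits of `M^u` (the circuits of the dual matroid) are exactly
the inclusion-minimal initial supports `supp(D, -u)` of valuated cocircuits `D` of `P`. -/
theorem initial_matroid_circuits_and_cocircuits
    {E : Type*} [Fintype E] [DecidableEq E] {Γ : Type*} [AddCommGroup Γ] [LinearOrder Γ] [IsOrderedAddMonoid Γ]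
    (r : ℕ) (P : Finset E → WithTop Γ)
    (hP : ∃ B : Finset E, B.card = r ∧ P B ≠ ⊤)
    (hpl : TropPlucker P r) (u : E → Γ) :
    ∃ M : Matroid E, M.E = Set.univ ∧
      (∀ B : Finset E, (M.IsBase ↑B ↔ InitBasis P r u B)) ∧
      (∀ C : Set E, Minimal M.Dep C ↔
        Minimal (fun S : Set E => ∃ τ : Finset E, τ.card = r + 1 ∧
          (∃ i ∈ τ, P (τ.erase i) ≠ ⊤) ∧ S = initSupp (circVec P τ) u) C) ∧
      (∀ D : Set E, Minimal M✶.Dep D ↔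
        Minimal (fun S : Set E => ∃ τ : Finset E, τ.card = Fintype.card E - r + 1 ∧
          (∃ i ∈ τ, dualFn P (τ.erase i) ≠ ⊤) ∧
          S = initSupp (circVec (dualFn P) τ) (fun i => - u i)) D) := by
  have hr : r ≤ Fintype.card E := by
    obtain ⟨B, hB, _⟩ := hP
    rw [← hB]
    exact Finset.card_le_univ B
  let M : Matroid E := Matroid.ofIsBaseOfFinite (E := Set.univ) Set.finite_univ
    (fun S => ∃ B : Finset E, InitBasis P r u B ∧ (B : Set E) = S)
    (by
      obtain ⟨B, hB⟩ := exists_initBasis P r hP u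
      exact ⟨B, B, hB, rfl⟩)
    (by
      rintro _ _ ⟨B, hB, rfl⟩ ⟨B', hB', rfl⟩ e he
      obtain ⟨f, hf, hf', h⟩ := initBasis_exchange hpl u hB hB' (e := e) he.1 he.2
      exact ⟨f, ⟨hf, hf'⟩, _, h, by simp⟩)
    (fun _ _ => Set.subset_univ _)
  have hM : ∀ B : Finset E, M.IsBase ↑B ↔ InitBasis P r u B := by
    intro B
    change (∃ B' : Finset E, InitBasis P r u B' ∧ (B' : Set E) = B) ↔ _
    simp
  have hE : M.E = Set.univ := rfl
  refine ⟨M, hE, hM, circuits_aux hpl u M hE hM, ?_⟩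
  refine circuits_aux (hpl.dual hr) (fun i => - u i) M✶ hE (fun B => ?_)
  rw [initBasis_dual P r hr, ← hM, Matroid.dual_isBase_iff (by rw [hE]; exact Set.subset_univ _), hE,
    Finset.coe_compl, Set.compl_eq_univ_sdiff]
end

section
/- Let P be a valuated matroid of rank r on a finite set E with values in a linearly ordered abelian group Γ. Then for every valuated circuit C of P, every valuated cocircuit D of P, and every u : E → Γ, the intersection supp(C, u) ∩ supp(D, −u) does not consist of exactly one element. -/
open scoped Classical

/-- For a valuated matroid `P` of rank `r`, a valuated circuit `C` of `P`, a
valuated cocircuit `D` of `P`, and any `u : E → Γ`, the intersection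
`supp(C, u) ∩ supp(D, -u)` never consists of exactly one element. -/
theorem initSupp_circuit_cocircuit_not_singleton
    {E : Type*} [Fintype E] [DecidableEq E] {Γ : Type*} [AddCommGroup Γ] [LinearOrder Γ] [IsOrderedAddMonoid Γ]
    (r : ℕ) (P : Finset E → WithTop Γ)
    (hP : ∃ B : Finset E, B.card = r ∧ P B ≠ ⊤)
    (hpl : TropPlucker P r)
    (τ τ' : Finset E) (hτ : τ.card = r + 1) (hτ' : τ'.card = Fintype.card E - r + 1)
    (hC : ∃ i ∈ τ, P (τ.erase i) ≠ ⊤) (hD : ∃ i ∈ τ', dualFn P (τ'.erase i) ≠ ⊤)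
    (u : E → Γ) :
    ¬ ∃ e : E, initSupp (circVec P τ) u ∩
        initSupp (circVec (dualFn P) τ') (fun i => - u i) = {e} := by
  rintro ⟨e, he⟩
  have hmem : e ∈ initSupp (circVec P τ) u ∩
        initSupp (circVec (dualFn P) τ') (fun i => - u i) := by rw [he]; rfl
  obtain ⟨⟨hc1, hc2⟩, ⟨hd1, hd2⟩⟩ := hmem
  have hcm : ∀ i, i ∈ τ → circVec P τ i = P (τ.erase i) := fun i hi => by simp [circVec, hi]
  have hdm : ∀ i, i ∈ τ' → circVec (dualFn P) τ' i = P (insert i τ'ᶜ) := fun i hi => by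
    simp [circVec, dualFn, hi, Finset.compl_erase]
  have heτ : e ∈ τ := by
    by_contra h
    exact hc1 (by simp [circVec, h])
  have heτ' : e ∈ τ' := by
    by_contra h
    exact hd1 (by simp [circVec, h])
  have hI : (τ'ᶜ).card + 1 = r := by
    obtain ⟨B, hB, -⟩ := hP
    have h1 := Finset.card_le_univ B
    have h2 := Finset.card_le_univ τ'
    rw [Finset.card_compl]
    omega
  have hS : ∀ k, k ∈ τ \ τ'ᶜ ↔ k ∈ τ ∧ k ∈ τ' := fun k => by simp
  have key : ∀ (a b c d : WithTop Γ) (x y : Γ), a ≠ ⊤ → b ≠ ⊤ →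
      a + (x : WithTop Γ) ≤ c + (y : WithTop Γ) →
      b + ((-x : Γ) : WithTop Γ) ≤ d + ((-y : Γ) : WithTop Γ) →
      b + a ≤ d + c ∧ (d + c = b + a → c ≠ ⊤ ∧ d ≠ ⊤ ∧
        c + (y : WithTop Γ) = a + (x : WithTop Γ) ∧
        d + ((-y : Γ) : WithTop Γ) = b + ((-x : Γ) : WithTop Γ)) := by
    intro a b c d x y ha hb h1 h2
    lift a to Γ using ha
    lift b to Γ using hb
    induction c using WithTop.recTopCoe with
    | top => simp [← WithTop.coe_add]
    | coe c =>
      induction d using WithTop.recTopCoe with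
      | top => simp [← WithTop.coe_add]
      | coe d =>
        norm_cast at h1 h2 ⊢
        have h3 := add_le_add h1 h2
        refine ⟨?_, fun h => ⟨WithTop.coe_ne_top, WithTop.coe_ne_top, ?_, ?_⟩⟩
        · calc b + a = a + x + (b + -x) := by abel
            _ ≤ c + y + (d + -y) := h3
            _ = d + c := by abel
        · have h4 : c + y + (d + -y) = a + x + (b + -x) := by
            calc _ = d + c := by abel
              _ = b + a := h
              _ = _ := by abel
          refine le_antisymm ?_ h1
          by_contra h5
          exact absurd h4 (add_lt_add_of_lt_of_le (not_le.mp h5) h2).ne'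
        · have h4 : c + y + (d + -y) = a + x + (b + -x) := by
            calc _ = d + c := by abel
              _ = b + a := h
              _ = _ := by abel
          refine le_antisymm ?_ h2
          by_contra h5
          exact absurd h4 (add_lt_add_of_le_of_lt h1 (not_le.mp h5)).ne'
  have key2 := fun k => key _ _ _ _ _ _ hc1 hd1 (hc2 k) (hd2 k)
  rcases hpl τ'ᶜ τ hI hτ e ((hS e).2 ⟨heτ, heτ'⟩) (fun k hk => by
    obtain ⟨hk1, hk2⟩ := (hS k).1 hk
    have := (key2 k).1
    rwa [hcm e heτ, hcm k hk1, hdm e heτ', hdm k hk2] at this) with h | ⟨k, hk, hne, h⟩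
  · rw [← hcm e heτ, ← hdm e heτ'] at h
    exact (WithTop.add_ne_top.2 ⟨hd1, hc1⟩) h
  · obtain ⟨hk1, hk2⟩ := (hS k).1 hk
    rw [← hcm e heτ, ← hcm k hk1, ← hdm e heτ', ← hdm k hk2] at h
    obtain ⟨q1, q2, q3, q4⟩ := (key2 k).2 h
    have : k ∈ ({e} : Set E) := by
      rw [← he]
      exact ⟨⟨q1, fun j => q3.trans_le (hc2 j)⟩, ⟨q2, fun j => q4.trans_le (hd2 j)⟩⟩
    exact hne this
end

section
/- Let P be a valuated matroid of rank r on a finite set E with values in a linearly ordered abelian group Γ, and for u : E → Γ let M^u denote the matroid on E whose bases are 𝓑^u(P). Then for every u : E → Γ the following are equivalent: (i) for every valuated circuit C of P, the minimum over i ∈ E of C_i + u_i is attained at at least two distinct indices; (ii) the matroid M^u has no loops, i.e. every element of E is contained in some basis of M^u. (This is the toric case of characterisation (iii) of Theorem D for F = 𝕂: a point u ∈ Γ^E lies in the tropical linear space of P if and only if its initial matroid M^u is loopless.) -/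
open scoped Classical

/-- Let `P` be a valuated matroid of rank `r` on `E` and `u : E → Γ`, and let
`M^u` be the matroid on `E` whose bases are `𝓑^u(P)`. Then the minimum of `C_i + u_i` is
attained at least twice for every valuated circuit `C` of `P` iff `M^u` has no loops, i.e.
every element of `E` is contained in some basis of `M^u`. -/
theorem initial_loopless_iff_min_attained_twice
    {E : Type*} [Fintype E] [DecidableEq E] {Γ : Type*} [AddCommGroup Γ] [LinearOrder Γ] [IsOrderedAddMonoid Γ]
    (r : ℕ) (P : Finset E → WithTop Γ)
    (hP : ∃ B : Finset E, B.card = r ∧ P B ≠ ⊤)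
    (hpl : TropPlucker P r) (u : E → Γ) :
    (∀ τ : Finset E, τ.card = r + 1 → (∃ i ∈ τ, P (τ.erase i) ≠ ⊤) →
      ∃ i j : E, i ≠ j ∧
        (∀ k, circVec P τ i + (u i : WithTop Γ) ≤ circVec P τ k + (u k : WithTop Γ)) ∧
        (∀ k, circVec P τ j + (u j : WithTop Γ) ≤ circVec P τ k + (u k : WithTop Γ))) ↔
    (∀ e : E, ∃ B : Finset E, InitBasis P r u B ∧ e ∈ B) := by
  constructor
  · intro h e
    obtain ⟨B, hBm, hBmin⟩ := Finset.exists_min_image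
      (Finset.univ.filter fun B : Finset E => B.card = r)
      (fun B => wsub (P B) (∑ i ∈ B, u i)) (by
        obtain ⟨B, hB, _⟩ := hP
        exact ⟨B, by simp [hB]⟩)
    have hBc : B.card = r := by simpa using hBm
    have hmin : ∀ B' : Finset E, B'.card = r →
        wsub (P B) (∑ i ∈ B, u i) ≤ wsub (P B') (∑ i ∈ B', u i) :=
      fun B' hB' => hBmin B' (by simp [hB'])
    have hBt : P B ≠ ⊤ := by
      intro ht
      obtain ⟨B', hB', hB't⟩ := hP
      have := hmin B' hB'
      obtain ⟨x, hx⟩ := WithTop.ne_top_iff_exists.mp hB't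
      rw [ht, ← hx] at this
      simp [wsub] at this
    by_cases he : e ∈ B
    · exact ⟨B, ⟨hBc, hBt, hmin⟩, he⟩
    have hee : (insert e B).erase e = B := Finset.erase_insert he
    obtain ⟨i, j, hij, hi, hj⟩ := h (insert e B) (by rw [Finset.card_insert_of_notMem he, hBc])
      ⟨e, by simp, by rwa [hee]⟩
    obtain ⟨k, hke, hk⟩ : ∃ k, k ≠ e ∧ circVec P (insert e B) k + (u k : WithTop Γ) ≤
        circVec P (insert e B) e + (u e : WithTop Γ) := by
      by_cases hie : i = e
      · exact ⟨j, fun h => hij (hie.trans h.symm), hj e⟩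
      · exact ⟨i, hie, hi e⟩
    obtain ⟨b, hb⟩ := WithTop.ne_top_iff_exists.mp hBt
    have hkB : k ∈ B := by
      by_contra hkB
      simp [circVec, hke, hkB, hee, ← hb, ← WithTop.coe_add] at hk
    have hki : k ∈ insert e B := by simp [hkB]
    simp only [circVec, if_pos hki, Finset.mem_insert_self, if_true, hee] at hk
    have hkt : P ((insert e B).erase k) ≠ ⊤ := by
      intro ht
      rw [ht, ← hb, ← WithTop.coe_add] at hk
      simp at hk
    obtain ⟨x, hx⟩ := WithTop.ne_top_iff_exists.mp hkt
    refine ⟨(insert e B).erase k, ⟨?_, hkt, ?_⟩, ?_⟩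
    · rw [Finset.card_erase_of_mem hki, Finset.card_insert_of_notMem he, hBc]; simp
    · intro B' hB'
      refine le_trans ?_ (hmin B' hB')
      have hs := Finset.add_sum_erase (insert e B) u hki
      rw [Finset.sum_insert he] at hs
      rw [← hx, ← hb] at hk ⊢
      simp only [wsub, WithTop.map_coe]
      norm_cast at hk ⊢
      have : ∑ i ∈ (insert e B).erase k, u i = u e + ∑ i ∈ B, u i - u k := by
        rw [← hs]; abel
      rw [this]
      have h2 := sub_le_sub_right hk (u e + ∑ i ∈ B, u i)
      convert h2 using 1 <;> abel
    · simp [Ne.symm hke]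
  · intro h τ hτ hex
    obtain ⟨i0, hi0, hi0t⟩ := hex
    have : Nonempty E := ⟨i0⟩
    obtain ⟨i, hi⟩ := Finite.exists_min fun i => circVec P τ i + (u i : WithTop Γ)
    have hit : circVec P τ i ≠ ⊤ := by
      intro ht
      have := hi i0
      obtain ⟨x, hx⟩ := WithTop.ne_top_iff_exists.mp hi0t
      rw [ht] at this
      simp [circVec, hi0, ← hx, ← WithTop.coe_add] at this
    have hiτ : i ∈ τ := by
      by_contra hc
      exact hit (by simp [circVec, hc])
    have hci : circVec P τ i = P (τ.erase i) := by simp [circVec, hiτ]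
    rw [hci] at hit
    obtain ⟨B, ⟨hBc, hBt, hmin⟩, hiB⟩ := h i
    obtain ⟨a, ha⟩ := WithTop.ne_top_iff_exists.mp hit
    obtain ⟨b, hb⟩ := WithTop.ne_top_iff_exists.mp hBt
    have hins : insert i (B.erase i) = B := Finset.insert_erase hiB
    have hsB := Finset.add_sum_erase B u hiB
    have hcard := Finset.card_erase_add_one hiB
    -- exchange inequality, in the group
    have hB2 : ∀ k ∈ τ \ B.erase i, ∀ y : Γ, (y : WithTop Γ) = P (insert k (B.erase i)) →
        b + u k ≤ y + u i := by
      intro k hk y hy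
      have hkI : k ∉ B.erase i := (Finset.mem_sdiff.mp hk).2
      have h1 := hmin (insert k (B.erase i)) (by
        rw [Finset.card_insert_of_notMem hkI, hcard, hBc])
      rw [← hb, ← hy, Finset.sum_insert hkI, ← hsB] at h1
      simp only [wsub, WithTop.map_coe] at h1
      norm_cast at h1
      have h2 := add_le_add_left h1 (u i + u k + ∑ x ∈ B.erase i, u x)
      convert h2 using 1 <;> abel
    rcases hpl (B.erase i) τ (by rw [hcard, hBc]) hτ i (by simp [hiτ]) (by
      intro k hk
      rw [hins]
      by_cases h1 : P (insert k (B.erase i)) = ⊤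
      · simp [h1]
      by_cases h2 : P (τ.erase k) = ⊤
      · simp [h2]
      obtain ⟨y, hy⟩ := WithTop.ne_top_iff_exists.mp h1
      obtain ⟨z, hz⟩ := WithTop.ne_top_iff_exists.mp h2
      have h3 := hB2 k hk y hy
      have h4 := hi k
      have hkτ := (Finset.mem_sdiff.mp hk).1
      simp only [circVec, if_pos hkτ, if_pos hiτ] at h4
      rw [← ha, ← hz] at h4
      rw [← ha, ← hb, ← hy, ← hz]
      norm_cast at h4 ⊢
      have h5 := sub_le_sub_right (add_le_add h3 h4) (u i + u k)
      convert h5 using 1 <;> abel) with ht | ⟨j, hj, hji, heq⟩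
    · rw [hins, ← ha, ← hb, ← WithTop.coe_add] at ht
      exact absurd ht (WithTop.coe_ne_top)
    · refine ⟨i, j, Ne.symm hji, hi, fun k => le_trans ?_ (hi k)⟩
      have hjτ := (Finset.mem_sdiff.mp hj).1
      simp only [circVec, if_pos hjτ, if_pos hiτ]
      rw [hins, ← ha, ← hb, ← WithTop.coe_add] at heq
      obtain ⟨y, z, hy, hz, hyz⟩ := WithTop.add_eq_coe.mp heq
      have h3 := hB2 j hj y hy
      rw [← hz, ← ha]
      norm_cast
      have h5 := sub_le_sub_right (add_le_add_left h3 z) b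
      have e1 : b + u j + z - b = z + u j := by abel
      have e2 : y + u i + z - b = a + u i := by
        have : a = y + z - b := by rw [hyz]; abel
        rw [this]; abel
      rwa [e1, e2] at h5
end

section
/- Let (σ, v) be an oriented valuated matroid of rank r on a finite linearly ordered set E with values in a linearly ordered abelian group Γ, and let u : E → Γ. For an (r+1)-subset τ = {i_0 < i_1 < ⋯ < i_r} of E, define the signed valuated vector C_τ = (c, w) ∈ ({+1,0,−1} × (Γ∪{∞}))^E by c_{i_k} = (−1)^k·σ(τ∖{i_k}) and w_{i_k} = v(τ∖{i_k}) for 0 ≤ k ≤ r, and c_i = 0, w_i = ∞ for i ∉ τ; the signed valuated circuits of (σ, v) are the vectors ±C_τ with c not identically 0. For a signed valuated vector C = (c, w), its initial vector C^u ∈ {+1,0,−1}^E is given by (C^u)_i = c_i if w_i ≠ ∞ and w_i + u_i ≤ w_j + u_j for all j ∈ E, and (C^u)_i = 0 otherwise. Also define, from the initial sign function σ^u, the vectors c'_τ ∈ {+1,0,−1}^E by (c'_τ)_{i_k} = (−1)^k·σ^u(τ∖{i_k}) for i_k ∈ τ and 0 elsewhere. Then the set of nonzero vectors ±c'_τ (the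 circuits of the initial chirotope σ^u) is exactly the set of those initial vectors ±C^u of signed valuated circuits C of (σ, v) whose support {i : (C^u)_i ≠ 0} is nonempty and inclusion-minimal among the supports of all such initial vectors. -/
open scoped Classical

/-- The sign part `c` of the signed valuated vector `C_τ`: `c_{i_k} = (-1)^k · σ(τ∖{i_k})` for
`i_k` the `k`-th smallest element of `τ`, and `0` outside `τ`. -/
def cVec {E : Type*} [LinearOrder E] (σ : Finset E → SignType) (τ : Finset E) :
    E → SignType :=
  fun i => if i ∈ τ then (-1 : SignType) ^ (τ.filter fun a => a < i).card * σ (τ.erase i) else 0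

/-- The valuation part `w` of the signed valuated vector `C_τ`: `w_i = v(τ∖{i})` for `i ∈ τ`,
and `∞` outside `τ`. -/
def wVec {E : Type*} [DecidableEq E] {Γ : Type*} [AddCommGroup Γ] [LinearOrder Γ] [IsOrderedAddMonoid Γ]
    (v : Finset E → WithTop Γ) (τ : Finset E) : E → WithTop Γ :=
  fun i => if i ∈ τ then v (τ.erase i) else ⊤

/-- The initial vector `C^u` of a signed valuated vector `C = (c, w)`: `(C^u)_i = c_i` if
`w_i ≠ ∞` and `w_i + u_i` is minimal, and `0` otherwise. -/
noncomputable def initVec {E : Type*} [Fintype E] {Γ : Type*} [AddCommGroup Γ] [LinearOrder Γ] [IsOrderedAddMonoid Γ]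
    (c : E → SignType) (w : E → WithTop Γ) (u : E → Γ) : E → SignType :=
  fun i => if w i ≠ ⊤ ∧ ∀ j, w i + (u i : WithTop Γ) ≤ w j + (u j : WithTop Γ)
    then c i else 0

/-- The circuit vector `c'_τ` of the initial chirotope `σ^u`:
`(c'_τ)_{i_k} = (-1)^k · σ^u(τ∖{i_k})` on `τ` and `0` elsewhere. -/
noncomputable def cPrime {E : Type*} [Fintype E] [LinearOrder E]
    {Γ : Type*} [AddCommGroup Γ] [LinearOrder Γ] [IsOrderedAddMonoid Γ]
    (σ : Finset E → SignType) (v : Finset E → WithTop Γ) (r : ℕ) (u : E → Γ)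
    (τ : Finset E) : E → SignType :=
  fun i => if i ∈ τ then
      (-1 : SignType) ^ (τ.filter fun a => a < i).card * initSign σ v r u (τ.erase i)
    else 0


section helpers
set_option linter.unusedSectionVars false
variable {E : Type*} [Fintype E] [LinearOrder E]
  {Γ : Type*} [AddCommGroup Γ] [LinearOrder Γ] [IsOrderedAddMonoid Γ]

def IsB (v : Finset E → WithTop Γ) (r : ℕ) (u : E → Γ) (B : Finset E) : Prop :=
  v B ≠ ⊤ ∧ ∀ B' : Finset E, B'.card = r →
      wsub (v B) (∑ i ∈ B, u i) ≤ wsub (v B') (∑ i ∈ B', u i)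

def InS (v : Finset E → WithTop Γ) (u : E → Γ) (τ : Finset E) (i : E) : Prop :=
  i ∈ τ ∧ v (τ.erase i) ≠ ⊤ ∧
    ∀ j ∈ τ, v (τ.erase i) + (u i : WithTop Γ) ≤ v (τ.erase j) + (u j : WithTop Γ)

lemma negpow_ne (n : ℕ) : (-1 : SignType) ^ n ≠ 0 := pow_ne_zero _ (by decide)

lemma negpow_cases (n : ℕ) : (-1 : SignType) ^ n = 1 ∨ (-1 : SignType) ^ n = -1 :=
  neg_one_pow_eq_or _ n

lemma cond_iff (v : Finset E → WithTop Γ) (u : E → Γ) (τ : Finset E) (i : E) :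
    (wVec v τ i ≠ ⊤ ∧ ∀ j, wVec v τ i + (u i : WithTop Γ) ≤ wVec v τ j + (u j : WithTop Γ)) ↔
      InS v u τ i := by
  unfold wVec InS
  by_cases hi : i ∈ τ
  · simp only [hi, if_true, true_and]
    refine and_congr Iff.rfl ⟨fun h j hj => by simpa [hj] using h j, fun h j => ?_⟩
    by_cases hj : j ∈ τ
    · simpa [hj] using h j hj
    · simp [hj]
  · simp [hi]

lemma initVec_eq (σ : Finset E → SignType) (v : Finset E → WithTop Γ) (u : E → Γ)
    (τ : Finset E) (i : E) :
    initVec (cVec σ τ) (wVec v τ) u i = if InS v u τ i then cVec σ τ i else 0 := by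
  unfold initVec
  simp only [cond_iff]

lemma initVec_ne (r : ℕ) (σ : Finset E → SignType) (v : Finset E → WithTop Γ)
    (hσv : ∀ B : Finset E, B.card = r → (σ B = 0 ↔ v B = ⊤)) (u : E → Γ)
    (τ : Finset E) (hτ : τ.card = r + 1) (i : E) :
    initVec (cVec σ τ) (wVec v τ) u i ≠ 0 ↔ InS v u τ i := by
  rw [initVec_eq]
  constructor
  · intro h; by_contra h'; simp [h'] at h
  · intro h
    rw [if_pos h]
    have h1 : (τ.erase i).card = r := by rw [Finset.card_erase_of_mem h.1, hτ]; simp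
    have := mt (hσv _ h1).1 h.2.1
    simp only [cVec, h.1, if_true]
    exact mul_ne_zero (negpow_ne _) this

lemma isB_inS (r : ℕ) (v : Finset E → WithTop Γ) (u : E → Γ)
    (τ : Finset E) (hτ : τ.card = r + 1) (i : E) (hi : i ∈ τ) (h : IsB v r u (τ.erase i)) (j : E) :
    InS v u τ j ↔ (j ∈ τ ∧ IsB v r u (τ.erase j)) := by
  have key : ∀ j ∈ τ, ∀ k ∈ τ, (v (τ.erase j) + (u j : WithTop Γ) ≤ v (τ.erase k) + (u k : WithTop Γ)
      ↔ wsub (v (τ.erase j)) (∑ i ∈ τ.erase j, u i) ≤ wsub (v (τ.erase k)) (∑ i ∈ τ.erase k, u i)) := by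
    intro j hj k hk
    have ej := Finset.sum_erase_add τ u hj
    have ek := Finset.sum_erase_add τ u hk
    generalize ∑ i ∈ τ.erase j, u i = a at *
    generalize ∑ i ∈ τ.erase k, u i = b at *
    generalize v (τ.erase j) = x at *
    generalize v (τ.erase k) = y at *
    cases y with
    | top => simp [wsub]
    | coe y =>
      cases x with
      | top => simp only [wsub, WithTop.map_top, WithTop.map_coe, top_add, ← WithTop.coe_add, top_le_iff, WithTop.coe_ne_top]
      | coe x =>
        simp only [wsub, WithTop.map_coe, ← WithTop.coe_add, WithTop.coe_le_coe]
        grind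
  have hc : ∀ k ∈ τ, (τ.erase k).card = r := fun k hk => by
    rw [Finset.card_erase_of_mem hk, hτ]; simp
  constructor
  · rintro ⟨h1, h2, h3⟩
    exact ⟨h1, h2, fun B' hB' => ((key j h1 i hi).1 (h3 i hi)).trans (h.2 B' hB')⟩
  · rintro ⟨h1, h2, h3⟩
    exact ⟨h1, h2, fun k hk => (key j h1 k hk).2 (h3 _ (hc k hk))⟩

lemma cPrime_eq (r : ℕ) (σ : Finset E → SignType) (v : Finset E → WithTop Γ) (u : E → Γ)
    (τ : Finset E) (hτ : τ.card = r + 1) (i : E) (hi : i ∈ τ) (h : IsB v r u (τ.erase i)) :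
    cPrime σ v r u τ = initVec (cVec σ τ) (wVec v τ) u := by
  funext j
  rw [initVec_eq, isB_inS r v u τ hτ i hi h j]
  unfold cPrime initSign cVec IsB
  by_cases hj : j ∈ τ
  · simp only [hj, if_true, true_and]
    split_ifs <;> simp
  · simp [hj]

lemma exch_s12 (r : ℕ) (σ : Finset E → SignType) (v : Finset E → WithTop Γ)
    (hovm : OrientedValuatedMatroid σ v r) (u : E → Γ)
    (B τ : Finset E) (hB : B.card = r) (hτ : τ.card = r + 1) (hb : IsB v r u B)
    (j : E) (hj : j ∈ B) (hjS : InS v u τ j) (ε : SignType) (hε : ε = 1 ∨ ε = -1) :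
    ∃ k, k ∉ B.erase j ∧ InS v u τ k ∧ IsB v r u (insert k (B.erase j)) ∧
      ssign k (B.erase j) τ * σ (insert k (B.erase j)) * σ (τ.erase k) = ε := by
  have hI : (B.erase j).card + 1 = r := by rw [Finset.card_erase_add_one hj, hB]
  have hjI : j ∉ B.erase j := Finset.notMem_erase j B
  have hins : insert j (B.erase j) = B := Finset.insert_erase hj
  have main : ∀ k ∈ τ \ B.erase j, (∀ l ∈ τ \ B.erase j,
      v (insert k (B.erase j)) + v (τ.erase k) ≤ v (insert l (B.erase j)) + v (τ.erase l)) →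
      InS v u τ k ∧ IsB v r u (insert k (B.erase j)) := by
    intro k hk hmin
    rw [Finset.mem_sdiff] at hk
    have h0 := hmin j (Finset.mem_sdiff.2 ⟨hjS.1, hjI⟩)
    rw [hins] at h0
    have h1 := hb.2 (insert k (B.erase j)) (by rw [Finset.card_insert_of_notMem hk.2, hI])
    have h2 := hjS.2.2 k hk.1
    have e1 := Finset.sum_insert (f := u) hk.2
    have e2 := Finset.sum_erase_add B u hj
    obtain ⟨a, ha⟩ := WithTop.ne_top_iff_exists.1 hb.1
    obtain ⟨b, hb'⟩ := WithTop.ne_top_iff_exists.1 hjS.2.1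
    have hfin : v (insert k (B.erase j)) + v (τ.erase k) ≠ ⊤ := by
      intro h; rw [h, ← ha, ← hb', ← WithTop.coe_add] at h0
      exact WithTop.coe_ne_top (top_le_iff.1 h0)
    obtain ⟨f1, f2⟩ := WithTop.add_ne_top.1 hfin
    obtain ⟨c, hc⟩ := WithTop.ne_top_iff_exists.1 f1
    obtain ⟨d, hd⟩ := WithTop.ne_top_iff_exists.1 f2
    rw [← ha, ← hb', ← hc, ← hd, ← WithTop.coe_add, ← WithTop.coe_add, WithTop.coe_le_coe] at h0
    rw [← ha, ← hc] at h1
    simp only [wsub, WithTop.map_coe, WithTop.coe_le_coe] at h1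
    rw [← hb', ← hd, ← WithTop.coe_add, ← WithTop.coe_add, WithTop.coe_le_coe] at h2
    refine ⟨⟨hk.1, f2, fun l hl => le_trans ?_ (hjS.2.2 l hl)⟩,
      f1, fun B' hB' => le_trans ?_ (hb.2 B' hB')⟩
    · rw [← hb', ← hd, ← WithTop.coe_add, ← WithTop.coe_add, WithTop.coe_le_coe]
      grind
    · rw [← ha, ← hc]
      simp only [wsub, WithTop.map_coe, WithTop.coe_le_coe]
      grind
  rcases hovm (B.erase j) τ hI hτ with h | ⟨⟨k, hk, hm, hs⟩, ⟨k', hk', hm', hs'⟩⟩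
  · exfalso
    have := h j (Finset.mem_sdiff.2 ⟨hjS.1, hjI⟩)
    rw [hins] at this
    exact (WithTop.add_ne_top.2 ⟨hb.1, hjS.2.1⟩) this
  · rcases hε with rfl | rfl
    · exact ⟨k, (Finset.mem_sdiff.1 hk).2, (main k hk hm).1, (main k hk hm).2, hs⟩
    · exact ⟨k', (Finset.mem_sdiff.1 hk').2, (main k' hk' hm').1, (main k' hk' hm').2, hs'⟩

lemma not_sub (r : ℕ) (σ : Finset E → SignType) (v : Finset E → WithTop Γ)
    (hovm : OrientedValuatedMatroid σ v r) (u : E → Γ)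
    (B τ : Finset E) (hB : B.card = r) (hτ : τ.card = r + 1) (hb : IsB v r u B)
    (j : E) (hjS : InS v u τ j) : ∃ k, k ∉ B ∧ InS v u τ k := by
  by_cases hj : j ∈ B
  · by_contra! hcon
    obtain ⟨k, h1, h2, h3, h4⟩ := exch_s12 r σ v hovm u B τ hB hτ hb j hj hjS 1 (Or.inl rfl)
    obtain ⟨k', h1', h2', h3', h4'⟩ := exch_s12 r σ v hovm u B τ hB hτ hb j hj hjS (-1) (Or.inr rfl)
    have a : k = j := by
      by_contra hne
      exact hcon k (fun h => h1 (Finset.mem_erase.2 ⟨hne, h⟩)) h2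
    have a' : k' = j := by
      by_contra hne
      exact hcon k' (fun h => h1' (Finset.mem_erase.2 ⟨hne, h⟩)) h2'
    subst a; subst a'
    rw [h4] at h4'
    exact absurd h4' (by decide)
  · exact ⟨j, hj, hjS⟩

lemma exists_isB (r : ℕ) (v : Finset E → WithTop Γ) (u : E → Γ)
    (h : ∃ B : Finset E, B.card = r ∧ v B ≠ ⊤) : ∃ B : Finset E, B.card = r ∧ IsB v r u B := by
  obtain ⟨B0, hB0, hv0⟩ := h
  obtain ⟨B, hB, hm⟩ := Finset.exists_min_image (Finset.univ.filter fun B : Finset E => B.card = r)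
    (fun B => wsub (v B) (∑ i ∈ B, u i)) ⟨B0, by simpa using hB0⟩
  simp only [Finset.mem_filter, Finset.mem_univ, true_and] at hB hm
  refine ⟨B, hB, ?_, hm⟩
  intro ht
  have := hm B0 hB0
  obtain ⟨a, ha⟩ := WithTop.ne_top_iff_exists.1 hv0
  rw [ht, ← ha] at this
  simp [wsub] at this

lemma exists_inS (r : ℕ) (σ : Finset E → SignType) (v : Finset E → WithTop Γ)
    (hσv : ∀ B : Finset E, B.card = r → (σ B = 0 ↔ v B = ⊤)) (u : E → Γ)
    (τ : Finset E) (hτ : τ.card = r + 1) (h : ∃ i, cVec σ τ i ≠ 0) : ∃ i, InS v u τ i := by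
  obtain ⟨i, hi⟩ := h
  have hiτ : i ∈ τ := by by_contra h; simp [cVec, h] at hi
  have hs : σ (τ.erase i) ≠ 0 := by intro h; simp [cVec, h] at hi
  have hv := mt (hσv _ (by rw [Finset.card_erase_of_mem hiτ, hτ]; simp)).2 hs
  obtain ⟨k, hk, hm⟩ := Finset.exists_min_image τ
    (fun i => v (τ.erase i) + (u i : WithTop Γ)) ⟨i, hiτ⟩
  refine ⟨k, hk, ?_, hm⟩
  intro ht
  have := hm i hiτ
  rw [ht, top_add, top_le_iff] at this
  exact (WithTop.add_ne_top.2 ⟨hv, WithTop.coe_ne_top⟩) this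

lemma pow_lt_gt (r : ℕ) (τ : Finset E) (hτ : τ.card = r + 1) (j : E) (hj : j ∈ τ) :
    (-1 : SignType) ^ (τ.filter fun a => a < j).card =
      (-1) ^ r * (-1) ^ (τ.filter fun a => j < a).card := by
  have h1 := Finset.card_filter_add_card_filter_not (s := τ.erase j) (fun a => a < j)
  have h2 : (τ.erase j).filter (fun a => a < j) = τ.filter fun a => a < j := by
    ext a; simp only [Finset.mem_filter, Finset.mem_erase]
    exact ⟨fun h => ⟨h.1.2, h.2⟩, fun h => ⟨⟨h.2.ne, h.1⟩, h.2⟩⟩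
  have h3 : (τ.erase j).filter (fun a => ¬ a < j) = τ.filter fun a => j < a := by
    ext a; simp only [Finset.mem_filter, Finset.mem_erase, not_lt]
    exact ⟨fun h => ⟨h.1.2, lt_of_le_of_ne h.2 (Ne.symm h.1.1)⟩, fun h => ⟨⟨h.2.ne', h.1⟩, h.2.le⟩⟩
  rw [h2, h3, Finset.card_erase_of_mem hj, hτ, Nat.add_sub_cancel] at h1
  rw [← h1, ← pow_add, add_assoc, pow_add, ← two_mul, pow_mul]
  simp

lemma sign_alg (R a b c d p q x y m n : SignType)
    (hR : R = 1 ∨ R = -1) (ha : a = 1 ∨ a = -1) (hb : b = 1 ∨ b = -1) (hc : c = 1 ∨ c = -1)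
    (hd : d = 1 ∨ d = -1) (hp : p = 1 ∨ p = -1) (hq : q = 1 ∨ q = -1)
    (h1 : a * p * x * m = -(b * q * y * n)) (h2 : c * p = - (d * q)) :
    (R * a * m) * (R * d * x) = (R * b * n) * (R * c * y) := by
  have sq : ∀ z : SignType, (z = 1 ∨ z = -1) → z * z = 1 := by decide
  have e : c = - (d * q * p) := by
    rw [← mul_one c, ← sq p hp, ← mul_assoc, h2, neg_mul]
  have e1 : a * (x * m) = -(b * q * y * n * p) := by
    have : a * (x * m) = (p * p) * (a * (x * m)) := by rw [sq p hp, one_mul]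
    rw [this, ← neg_mul, ← h1]; ac_rfl
  have l : (R * a * m) * (R * d * x) = (R * R) * d * (a * (x * m)) := by ac_rfl
  rw [l, e1, e]
  simp only [mul_neg, neg_mul]
  congr 1
  ac_rfl

lemma rel (r : ℕ) (σ : Finset E → SignType) (v : Finset E → WithTop Γ)
    (hovm : OrientedValuatedMatroid σ v r) (u : E → Γ)
    (B τ : Finset E) (hB : B.card = r) (hτ : τ.card = r + 1) (hb : IsB v r u B)
    (j s : E) (hj : j ∈ B) (hjS : InS v u τ j) (hsub : ∀ k, InS v u τ k → k ∈ insert s B) :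
    ssign j (B.erase j) τ * σ B * σ (τ.erase j) =
      -(ssign s (B.erase j) τ * σ (insert s (B.erase j)) * σ (τ.erase s)) := by
  obtain ⟨k, h1, h2, h3, h4⟩ := exch_s12 r σ v hovm u B τ hB hτ hb j hj hjS 1 (Or.inl rfl)
  obtain ⟨k', h1', h2', h3', h4'⟩ := exch_s12 r σ v hovm u B τ hB hτ hb j hj hjS (-1) (Or.inr rfl)
  have hc : ∀ k, k ∉ B.erase j → InS v u τ k → k = j ∨ k = s := by
    intro k hk hk2
    have := hsub k hk2
    simp only [Finset.mem_insert, Finset.mem_erase] at this hk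
    tauto
  have hins : insert j (B.erase j) = B := Finset.insert_erase hj
  rcases hc k h1 h2 with rfl | rfl <;> rcases hc k' h1' h2' with rfl | rfl
  · rw [h4] at h4'; exact absurd h4' (by decide)
  · rw [hins] at h4
    rw [h4, h4']; rfl
  · rw [hins] at h4'
    rw [h4, h4']
  · rw [h4] at h4'; exact absurd h4' (by decide)

lemma signs (r : ℕ) (σ : Finset E → SignType) (v : Finset E → WithTop Γ)
    (hσv : ∀ B : Finset E, B.card = r → (σ B = 0 ↔ v B = ⊤))
    (hovm : OrientedValuatedMatroid σ v r) (u : E → Γ)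
    (B τ : Finset E) (hB : B.card = r) (hτ : τ.card = r + 1) (hb : IsB v r u B)
    (j s : E) (hs : s ∉ B) (hj : j ∈ B) (hjS : InS v u τ j) (hsS : InS v u τ s)
    (hjS' : InS v u (insert s B) j)
    (hsub : ∀ k, InS v u τ k → k ∈ insert s B) :
    cVec σ τ j * cVec σ (insert s B) s = cVec σ τ s * cVec σ (insert s B) j := by
  have hcard : (insert s B).card = r + 1 := by rw [Finset.card_insert_of_notMem hs, hB]
  have r1 := rel r σ v hovm u B τ hB hτ hb j s hj hjS hsub
  have r2 := rel r σ v hovm u B (insert s B) hB hcard hb j s hj hjS' (fun k hk => hk.1)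
  have hne : j ≠ s := fun h => hs (h ▸ hj)
  have e1 : (insert s B).erase s = B := Finset.erase_insert hs
  have e2 : (insert s B).erase j = insert s (B.erase j) :=
    Finset.erase_insert_of_ne hne.symm
  have hx : σ B ≠ 0 := mt (hσv _ hB).1 hb.1
  have hy : σ (insert s (B.erase j)) ≠ 0 := by
    rw [← e2]
    refine mt (hσv _ ?_).1 hjS'.2.1
    rw [Finset.card_erase_of_mem hjS'.1, hcard]; simp
  have canc : ∀ p q x y : SignType, x ≠ 0 → y ≠ 0 → p * x * y = -(q * y * x) → p = -q := by
    decide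
  rw [e1, e2] at r2
  have r2' := canc _ _ _ _ hx hy r2
  unfold ssign at r1 r2'
  rw [pow_add, pow_add] at r1 r2'
  have hs' : s ∈ insert s B := Finset.mem_insert_self _ _
  simp only [cVec, hjS.1, hsS.1, hjS'.1, hs', if_true, e1, e2]
  rw [pow_lt_gt r τ hτ j hjS.1, pow_lt_gt r τ hτ s hsS.1, pow_lt_gt r _ hcard j hjS'.1,
    pow_lt_gt r _ hcard s hs']
  exact sign_alg _ _ _ _ _ _ _ _ _ _ _ (negpow_cases _) (negpow_cases _) (negpow_cases _)
    (negpow_cases _) (negpow_cases _) (negpow_cases _) (negpow_cases _) r1 r2'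

lemma back (r : ℕ) (σ : Finset E → SignType) (v : Finset E → WithTop Γ)
    (hσv : ∀ B : Finset E, B.card = r → (σ B = 0 ↔ v B = ⊤))
    (hσ : ∃ B : Finset E, B.card = r ∧ σ B ≠ 0)
    (hovm : OrientedValuatedMatroid σ v r) (u : E → Γ)
    (τ : Finset E) (hτ : τ.card = r + 1) (j0 : E) (hj0 : InS v u τ j0)
    (hmin : ∀ τ' : Finset E, τ'.card = r + 1 → (∃ i : E, cVec σ τ' i ≠ 0) →
      (∀ k, InS v u τ' k → InS v u τ k) → (∀ k, InS v u τ k → InS v u τ' k)) :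
    ∃ τ' : Finset E, τ'.card = r + 1 ∧
      (initVec (cVec σ τ) (wVec v τ) u = cPrime σ v r u τ' ∨
       initVec (cVec σ τ) (wVec v τ) u = -cPrime σ v r u τ') := by
  obtain ⟨B1, hB1, hs1⟩ := hσ
  obtain ⟨B0, hB0, hb0⟩ := exists_isB r v u ⟨B1, hB1, mt (hσv _ hB1).2 hs1⟩
  obtain ⟨B, hBm, hmax⟩ := Finset.exists_max_image
    (Finset.univ.filter fun B : Finset E => B.card = r ∧ IsB v r u B)
    (fun B => (B.filter fun i => InS v u τ i).card) ⟨B0, by simp [hB0, hb0]⟩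
  simp only [Finset.mem_filter, Finset.mem_univ, true_and] at hBm hmax
  obtain ⟨hB, hb⟩ := hBm
  obtain ⟨s, hs, hsS⟩ := not_sub r σ v hovm u B τ hB hτ hb j0 hj0
  have hcard : (insert s B).card = r + 1 := by rw [Finset.card_insert_of_notMem hs, hB]
  have e1 : (insert s B).erase s = B := Finset.erase_insert hs
  have hs' : s ∈ insert s B := Finset.mem_insert_self _ _
  have hbs : IsB v r u ((insert s B).erase s) := by rw [e1]; exact hb
  have hiff := isB_inS r v u (insert s B) hcard s hs' hbs
  have hsub : ∀ k, InS v u (insert s B) k → InS v u τ k := by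
    intro k hk
    by_contra hkS
    obtain ⟨hk1, hk2⟩ := (hiff k).1 hk
    have hm := hmax _ ⟨by rw [Finset.card_erase_of_mem hk1, hcard]; simp, hk2⟩
    have : insert s (B.filter fun i => InS v u τ i) ⊆
        ((insert s B).erase k).filter fun i => InS v u τ i := by
      intro a ha
      rw [Finset.mem_insert, Finset.mem_filter] at ha
      rw [Finset.mem_filter, Finset.mem_erase, Finset.mem_insert]
      rcases ha with rfl | ⟨h1, h2⟩
      · exact ⟨⟨fun h => hkS (h ▸ hsS), Or.inl rfl⟩, hsS⟩
      · exact ⟨⟨fun h => hkS (h ▸ h2), Or.inr h1⟩, h2⟩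
    have h2 := Finset.card_le_card this
    rw [Finset.card_insert_of_notMem (fun h => hs (Finset.mem_filter.1 h).1)] at h2
    omega
  have hx : σ B ≠ 0 := mt (hσv _ hB).1 hb.1
  have hsup := hmin (insert s B) hcard
    ⟨s, by simp only [cVec, hs', if_true, e1]; exact mul_ne_zero (negpow_ne _) hx⟩ hsub
  have hcp := cPrime_eq r σ v u (insert s B) hcard s hs' hbs
  refine ⟨insert s B, hcard, ?_⟩
  rw [hcp]
  have hrel : ∀ j, InS v u τ j →
      cVec σ τ j * cVec σ (insert s B) s = cVec σ τ s * cVec σ (insert s B) j := by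
    intro j hj
    by_cases hjs : j = s
    · subst hjs; rfl
    · have hjB : j ∈ B := by
        have := (hsup j hj).1
        rw [Finset.mem_insert] at this
        tauto
      exact signs r σ v hσv hovm u B τ hB hτ hb j s hs hjB hj hsS (hsup j hj)
        (fun k hk => (hsup k hk).1)
  have hXs : cVec σ τ s ≠ 0 := by
    have := (initVec_ne r σ v hσv u τ hτ s).2 hsS
    rwa [initVec_eq, if_pos hsS] at this
  have hYs : cVec σ (insert s B) s ≠ 0 := by
    have := (initVec_ne r σ v hσv u _ hcard s).2 (hsup s hsS)
    rwa [initVec_eq, if_pos (hsup s hsS)] at this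
  have alg1 : ∀ x y : SignType, x ≠ 0 → y ≠ 0 → x = y ∨ x = -y := by decide
  have alg2 : ∀ a y b : SignType, y ≠ 0 → a * y = y * b → a = b := by decide
  have alg3 : ∀ a y b : SignType, y ≠ 0 → a * y = -y * b → a = -b := by decide
  rcases alg1 _ _ hXs hYs with h | h
  · left
    funext j
    rw [initVec_eq, initVec_eq]
    by_cases hj : InS v u τ j
    · rw [if_pos hj, if_pos (hsup j hj)]
      have := hrel j hj
      rw [h] at this
      exact alg2 _ _ _ hYs this
    · rw [if_neg hj, if_neg (fun h' => hj (hsub j h'))]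
  · right
    funext j
    rw [Pi.neg_apply, initVec_eq, initVec_eq]
    by_cases hj : InS v u τ j
    · rw [if_pos hj, if_pos (hsup j hj)]
      have := hrel j hj
      rw [h] at this
      exact alg3 _ _ _ hYs this
    · rw [if_neg hj, if_neg (fun h' => hj (hsub j h'))]; rfl

lemma supp_pm (x y : E → SignType) (h : x = y ∨ x = -y) : ∀ i, x i ≠ 0 ↔ y i ≠ 0 := by
  have alg : ∀ a : SignType, -a ≠ 0 ↔ a ≠ 0 := by decide
  rcases h with rfl | rfl
  · exact fun i => Iff.rfl
  · exact fun i => alg _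

lemma pm_trans (x y z : E → SignType) (h : x = y ∨ x = -y) (h' : y = z ∨ y = -z) :
    x = z ∨ x = -z := by
  have alg : ∀ a : SignType, - -a = a := by decide
  have hz : - -z = z := funext fun i => alg _
  rcases h with rfl | rfl <;> rcases h' with rfl | rfl <;> simp [hz]

end helpers

/-- For an oriented valuated matroid `(σ, v)` of rank `r` and `u : E → Γ`,
the nonzero vectors `±c'_τ` (the circuits of the initial chirotope `σ^u`) are exactly the
initial vectors `±C^u` of signed valuated circuits `C` of `(σ, v)` whose support is nonempty
and inclusion-minimal among the supports of all such initial vectors. -/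
theorem initial_chirotope_circuits_eq_minimal_initial_vectors
    {E : Type*} [Fintype E] [LinearOrder E] {Γ : Type*} [AddCommGroup Γ] [LinearOrder Γ] [IsOrderedAddMonoid Γ]
    (r : ℕ) (σ : Finset E → SignType) (v : Finset E → WithTop Γ)
    (hσv : ∀ B : Finset E, B.card = r → (σ B = 0 ↔ v B = ⊤))
    (hσ : ∃ B : Finset E, B.card = r ∧ σ B ≠ 0)
    (hovm : OrientedValuatedMatroid σ v r) (u : E → Γ) :
    {x : E → SignType | x ≠ 0 ∧ ∃ τ : Finset E, τ.card = r + 1 ∧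
        (x = cPrime σ v r u τ ∨ x = -cPrime σ v r u τ)} =
    {x : E → SignType | ∃ τ : Finset E, τ.card = r + 1 ∧ (∃ i : E, cVec σ τ i ≠ 0) ∧
        (x = initVec (cVec σ τ) (wVec v τ) u ∨ x = -initVec (cVec σ τ) (wVec v τ) u) ∧
        {i : E | x i ≠ 0}.Nonempty ∧
        Minimal (fun S : Set E => ∃ τ' : Finset E, τ'.card = r + 1 ∧
            (∃ i : E, cVec σ τ' i ≠ 0) ∧
            S = {i : E | initVec (cVec σ τ') (wVec v τ') u i ≠ 0})
          {i : E | x i ≠ 0}} := by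
  ext x
  simp only [Set.mem_setOf_eq]
  constructor
  · rintro ⟨hx0, τ, hτ, hx⟩
    obtain ⟨i, hi⟩ := Function.ne_iff.1 hx0
    have hi' := (supp_pm _ _ hx i).1 hi
    have hiτ : i ∈ τ := by by_contra h; simp [cPrime, h] at hi'
    have hb : IsB v r u (τ.erase i) := by
      by_contra h
      apply hi'
      unfold cPrime initSign
      unfold IsB at h
      rw [if_pos hiτ, if_neg h, mul_zero]
    have hcp := cPrime_eq r σ v u τ hτ i hiτ hb
    rw [hcp] at hx
    have hsup : ∀ k, x k ≠ 0 ↔ InS v u τ k := fun k =>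
      (supp_pm _ _ hx k).trans (initVec_ne r σ v hσv u τ hτ k)
    have hiS := (hsup i).1 hi
    have hc : ∃ i : E, cVec σ τ i ≠ 0 := by
      refine ⟨i, ?_⟩
      have := (initVec_ne r σ v hσv u τ hτ i).2 hiS
      rwa [initVec_eq, if_pos hiS] at this
    refine ⟨τ, hτ, hc, hx, ⟨i, hi⟩, ⟨τ, hτ, hc, ?_⟩, ?_⟩
    · ext k
      exact supp_pm _ _ hx k
    · rintro T ⟨τ', hτ', hc', rfl⟩ hT k hk
      by_contra hk'
      rw [Set.mem_setOf_eq, initVec_ne r σ v hσv u τ' hτ'] at hk'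
      obtain ⟨hkτ, hkb⟩ := (isB_inS r v u τ hτ i hiτ hb k).1 ((hsup k).1 hk)
      obtain ⟨j, hj⟩ := exists_inS r σ v hσv u τ' hτ' hc'
      obtain ⟨l, hl, hlS⟩ := not_sub r σ v hovm u (τ.erase k) τ'
        (by rw [Finset.card_erase_of_mem hkτ, hτ]; simp) hτ' hkb j hj
      have hlx := hT ((initVec_ne r σ v hσv u τ' hτ' l).2 hlS)
      have hlτ := ((hsup l).1 hlx).1
      exact hl (Finset.mem_erase.2 ⟨fun h => hk' (h ▸ hlS), hlτ⟩)
  · rintro ⟨τ, hτ, hc, hx, ⟨i, hi⟩, -, hmin⟩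
    have hsup : ∀ k, x k ≠ 0 ↔ InS v u τ k := fun k =>
      (supp_pm _ _ hx k).trans (initVec_ne r σ v hσv u τ hτ k)
    refine ⟨fun h => hi (by rw [h]; rfl), ?_⟩
    obtain ⟨τ', hτ', h⟩ := back r σ v hσv hσ hovm u τ hτ i ((hsup i).1 hi) (by
      intro τ' hτ' hc' hsub k hk
      refine (initVec_ne r σ v hσv u τ' hτ' k).1 (hmin ⟨τ', hτ', hc', rfl⟩ ?_ ((hsup k).2 hk))
      intro l hl
      exact (hsup l).2 (hsub l ((initVec_ne r σ v hσv u τ' hτ' l).1 hl)))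
    exact ⟨τ', hτ', pm_trans _ _ _ hx h⟩
end
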